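/- arXiv:1409.3517 — 8 statements merged into one kernel-verified Lean document; each statement's English description precedes it below -/
import Mathlib

section
/- Let g be a finite-dimensional semisimple Lie algebra over ℂ with Killing form κ, let θ be a Lie algebra automorphism of g with θ^m = id, ξ_m = exp(2πi/m), and let g_i be the ξ_m^i-eigenspace of θ. Let X ∈ g_1 be regular semisimple, i.e. ad X is semisimple and s := ker(ad X) is a Cartan subalgebra. Set b := im(ad X) (the range of ad X : g → g). Then: (a) g = s ⊕ b; (b) b is the orthogonal complement of s with respect to κ; (c) for every i ∈ ℤ/mℤ one has b ∩ g_{i+1} = ⁅X, b ∩ g_i⁆. -/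
/-- The centralizer of an element `X` of a Lie algebra, as a Lie subalgebra. -/
def centralizerSubalgebra (K : Type*) (g : Type*) [CommRing K] [LieRing g]
    [LieAlgebra K g] (X : g) : LieSubalgebra K g where
  carrier := {y | ⁅X, y⁆ = 0}
  add_mem' := by
    intro a b ha hb
    simp only [Set.mem_setOf_eq, lie_add] at *
    rw [ha, hb, add_zero]
  zero_mem' := by simp
  smul_mem' := by
    intro c a ha
    simp only [Set.mem_setOf_eq, lie_smul] at *
    rw [ha, smul_zero]
  lie_mem' := by
    intro a b ha hb
    simp only [Set.mem_setOf_eq] at *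
    rw [leibniz_lie, ha, hb]
    simp

/-- The kernel and the range of a semisimple endomorphism of a finite-dimensional vector space
are complementary. -/
theorem Module.End.IsSemisimple.isCompl_ker_range {K V : Type*} [Field K] [AddCommGroup V]
    [Module K V] [FiniteDimensional K V] {f : Module.End K V} (hf : f.IsSemisimple) :
    IsCompl (LinearMap.ker f) (LinearMap.range f) := by
  have hdisj : Disjoint (LinearMap.ker f) (LinearMap.range f) := by
    obtain ⟨q, hq, hc⟩ := Module.End.isSemisimple_iff.mp hf (LinearMap.ker f) (by
      intro x hx
      rw [Submodule.mem_comap, LinearMap.mem_ker.mp hx]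
      exact zero_mem _)
    refine hc.disjoint.mono_right ?_
    rintro _ ⟨x, rfl⟩
    obtain ⟨u, hu, v, hv, rfl⟩ := Submodule.mem_sup.mp (hc.sup_eq_top ▸ Submodule.mem_top (x := x))
    rw [map_add, LinearMap.mem_ker.mp hu, zero_add]
    exact hq hv
  refine ⟨hdisj, codisjoint_iff.mpr (Submodule.eq_top_of_disjoint _ _ ?_ hdisj)⟩
  rw [add_comm, LinearMap.finrank_range_add_finrank_ker]

/-- If `ad X` is semisimple, then in a Lie algebra with nondegenerate Killing form its range is
the Killing-orthogonal complement of its kernel. -/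
theorem LieAlgebra.mem_range_ad_iff_killingForm_eq_zero {K L : Type*} [Field K] [LieRing L]
    [LieAlgebra K L] [Module.Finite K L] [LieAlgebra.IsKilling K L] {X : L}
    (hX : (LieAlgebra.ad K L X).IsSemisimple) (y : L) :
    y ∈ LinearMap.range (LieAlgebra.ad K L X) ↔
      ∀ v ∈ LinearMap.ker (LieAlgebra.ad K L X), killingForm K L v y = 0 := by
  have horth : ∀ v ∈ LinearMap.ker (LieAlgebra.ad K L X), ∀ z : L,
      killingForm K L v ⁅X, z⁆ = 0 := by
    intro v hv z
    have hvX : ⁅v, X⁆ = 0 := by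
      rw [← lie_skew, ← LieAlgebra.ad_apply K, LinearMap.mem_ker.mp hv, neg_zero]
    rw [← LieModule.traceForm_apply_lie_apply, hvX, map_zero, LinearMap.zero_apply]
  constructor
  · rintro ⟨z, rfl⟩ v hv
    exact horth v hv z
  · intro hy
    have hsup := hX.isCompl_ker_range.sup_eq_top
    obtain ⟨u, hu, _, ⟨z, rfl⟩, rfl⟩ := Submodule.mem_sup.mp (hsup ▸ Submodule.mem_top (x := y))
    suffices hu0 : u = 0 by
      rw [hu0, zero_add]
      exact ⟨z, rfl⟩
    have huker : u ∈ LinearMap.ker (killingForm K L) := by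
      refine LinearMap.mem_ker.mpr (LinearMap.ext fun w => ?_)
      obtain ⟨v, hv, _, ⟨z', rfl⟩, rfl⟩ :=
        Submodule.mem_sup.mp (hsup ▸ Submodule.mem_top (x := w))
      have hvu := hy v hv
      rw [map_add, LieAlgebra.ad_apply, horth v hv z, add_zero] at hvu
      rw [map_add, LieAlgebra.ad_apply, horth u hu z', add_zero,
        LieModule.traceForm_comm, hvu, LinearMap.zero_apply]
    rwa [LieAlgebra.IsKilling.ker_killingForm_eq_bot, Submodule.mem_bot] at huker

/-- Let `θ` be a linear map respecting the bracket, `X` an eigenvector of `θ` with eigenvalue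
`ξ ≠ 0`, and suppose the kernel and range of `ad X` are complementary. Then `ad X` maps the
`μ`-eigenvectors in its range onto the `μ * ξ`-eigenvectors in its range. -/
theorem LieAlgebra.map_ad_range_inf_eigenspace {K L : Type*} [Field K] [LieRing L]
    [LieAlgebra K L] {θ : Module.End K L} (hθ : ∀ x y : L, θ ⁅x, y⁆ = ⁅θ x, θ y⁆)
    {X : L} {ξ : K} (hξ : ξ ≠ 0) (hX : θ X = ξ • X)
    (hc : IsCompl (LinearMap.ker (LieAlgebra.ad K L X)) (LinearMap.range (LieAlgebra.ad K L X)))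
    (μ : K) :
    Submodule.map (LieAlgebra.ad K L X)
        (LinearMap.range (LieAlgebra.ad K L X) ⊓ θ.eigenspace μ) =
      LinearMap.range (LieAlgebra.ad K L X) ⊓ θ.eigenspace (μ * ξ) := by
  have hθX : ∀ y : L, θ ⁅X, y⁆ = ξ • ⁅X, θ y⁆ := fun y => by rw [hθ, hX, smul_lie]
  apply le_antisymm
  · rintro _ ⟨y, ⟨-, hy⟩, rfl⟩
    refine ⟨⟨y, rfl⟩, Module.End.mem_eigenspace_iff.mpr ?_⟩
    rw [LieAlgebra.ad_apply, hθX, Module.End.mem_eigenspace_iff.mp hy, lie_smul, smul_smul,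
      mul_comm]
  · rintro _ ⟨⟨z, rfl⟩, hy⟩
    obtain ⟨u, hu, v, hv, rfl⟩ :=
      Submodule.mem_sup.mp (hc.sup_eq_top ▸ Submodule.mem_top (x := z))
    rw [map_add, LinearMap.mem_ker.mp hu, zero_add] at hy ⊢
    refine ⟨v, ⟨hv, Module.End.mem_eigenspace_iff.mpr (sub_eq_zero.mp ?_)⟩, rfl⟩
    refine Submodule.disjoint_def.mp hc.disjoint _ ?_ (sub_mem ?_ (Submodule.smul_mem _ _ hv))
    · have h := Module.End.mem_eigenspace_iff.mp hy
      rw [LieAlgebra.ad_apply, hθX, mul_comm, mul_smul] at h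
      rw [LinearMap.mem_ker, LieAlgebra.ad_apply, lie_sub, lie_smul,
        smul_right_injective L hξ h, sub_self]
    · obtain ⟨w, rfl⟩ := hv
      rw [LieAlgebra.ad_apply, hθX]
      exact Submodule.smul_mem _ _ ⟨θ w, rfl⟩

/-- Let `g` be a finite-dimensional complex semisimple Lie algebra,
`θ` an automorphism with `θ^m = 1` and `gᵢ` its `ξ_m^i`-eigenspaces. Let `X ∈ g₁` be
regular semisimple with centralizer `s = ker (ad X)` and set `b = im (ad X)`. Then
(a) `g = s ⊕ b`; (b) `b` is the Killing-orthogonal complement of `s`;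
(c) `b ⊓ g_{i+1} = ⁅X, b ⊓ gᵢ⁆` for every `i`. -/
theorem image_ad_graded_decomposition
    (g : Type*) [LieRing g] [LieAlgebra ℂ g] [Module.Finite ℂ g]
    [LieAlgebra.IsSemisimple ℂ g]
    (m : ℕ) (hm : 0 < m)
    (ξ : ℂ) (hξ : ξ = Complex.exp (2 * Real.pi * Complex.I / m))
    (θ : Module.End ℂ g) (hθlie : ∀ x y : g, θ ⁅x, y⁆ = ⁅θ x, θ y⁆)
    (hθm : θ ^ m = 1)
    (gi : ℤ → Submodule ℂ g)
    (hgi : ∀ i : ℤ, gi i = Module.End.eigenspace θ (ξ ^ i))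
    (X : g) (hX : X ∈ gi 1)
    (hss : (LieAlgebra.ad ℂ g X).IsSemisimple)
    (s : Submodule ℂ g) (hs : s = LinearMap.ker (LieAlgebra.ad ℂ g X))
    (hCartan : (centralizerSubalgebra ℂ g X).IsCartanSubalgebra)
    (b : Submodule ℂ g) (hb : b = LinearMap.range (LieAlgebra.ad ℂ g X)) :
    (s ⊓ b = ⊥ ∧ s ⊔ b = ⊤) ∧
    (∀ y : g, y ∈ b ↔ ∀ v ∈ s, killingForm ℂ g v y = 0) ∧
    (∀ i : ℤ, Submodule.map (LieAlgebra.ad ℂ g X) (b ⊓ gi i) = b ⊓ gi (i + 1)) := by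
  have hξ0 : ξ ≠ 0 := hξ ▸ Complex.exp_ne_zero _
  have hc := hss.isCompl_ker_range
  have hθX : θ X = ξ • X := by
    rw [hgi, zpow_one] at hX
    exact Module.End.mem_eigenspace_iff.mp hX
  subst hs hb
  refine ⟨⟨hc.inf_eq_bot, hc.sup_eq_top⟩,
    LieAlgebra.mem_range_ad_iff_killingForm_eq_zero hss, fun i => ?_⟩
  rw [hgi, hgi, zpow_add_one₀ hξ0]
  exact LieAlgebra.map_ad_range_inf_eigenspace hθlie hξ0 hθX hc (ξ ^ i)
end

section
/- Let g be a finite-dimensional semisimple Lie algebra over ℂ with Killing form κ, θ an automorphism of g with θ^m = id, ξ_m = exp(2πi/m), and g_i the ξ_m^i-eigenspace of θ. Let L := ℂ[u,u⁻¹] ⊗_ℂ g be the loop Lie algebra (with bracket ⁅u^i⊗x, u^j⊗y⁆ = u^{i+j}⊗⁅x,y⁆), let g(θ,m) := ⊕_{i∈ℤ} u^i ⊗ g_{i mod m} ⊆ L, a ℤ-graded Lie subalgebra with graded pieces g(θ,m)_i := u^i ⊗ g_{i mod m}, and let ⟨·,·⟩ be the symmetric bilinear form on L determined by ⟨u^i⊗x,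 u^j⊗y⟩ = δ_{i,-j}·κ(x,y). Let X ∈ g_1 be regular semisimple (ad X semisimple with ker(ad X) a Cartan subalgebra) and set p := u⊗X ∈ g(θ,m)_1. Then g(θ,m) = a ⊕ c, where a := {ξ ∈ g(θ,m) : ⁅p, ξ⁆ = 0} and c := ⁅p, g(θ,m)⁆, and moreover ⟨a, c⟩ = 0. -/
open TensorProduct LaurentPolynomial

/-- The loop algebra `ℂ[T,T⁻¹] ⊗ g` is a complex Lie algebra. -/
noncomputable instance loopLieAlgebra (g : Type*) [LieRing g] [LieAlgebra ℂ g] :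
    LieAlgebra ℂ (LaurentPolynomial ℂ ⊗[ℂ] g) :=
  { (inferInstance : Module ℂ (LaurentPolynomial ℂ ⊗[ℂ] g)) with
    lie_smul := fun c x y => by
      rw [← algebraMap_smul (LaurentPolynomial ℂ) c y,
        lie_smul ((algebraMap ℂ (LaurentPolynomial ℂ)) c) x y,
        algebraMap_smul] }

/-- A semisimple endomorphism can be recovered from its square by composition on either side. -/
theorem Module.End.IsSemisimple.exists_sq_mul_eq {K V : Type*} [Field K] [AddCommGroup V]
    [Module K V] [Module.Finite K V] {A : Module.End K V} (hA : A.IsSemisimple) :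
    ∃ C : Module.End K V, C * A ^ 2 = A ∧ A ^ 2 * C = A := by
  have hsq := hA.minpoly_squarefree
  obtain ⟨q, r, hqr⟩ : ∃ q r : Polynomial K,
      q * Polynomial.X ^ 2 + r * minpoly K A = Polynomial.X := by
    by_cases h : Polynomial.X ∣ minpoly K A
    · obtain ⟨s, hs⟩ := h
      have hcop : IsCoprime Polynomial.X s := by
        rw [hs] at hsq
        exact (squarefree_mul_iff.mp hsq).1.isCoprime
      obtain ⟨q, r, hqr⟩ := hcop
      exact ⟨q, r, by rw [hs]; linear_combination Polynomial.X * hqr⟩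
    · obtain ⟨q, r, hqr⟩ :=
        (Polynomial.irreducible_X (R := K)).coprime_iff_not_dvd.mpr h
      exact ⟨q, r * Polynomial.X, by linear_combination Polynomial.X * hqr⟩
  have key : Polynomial.aeval A q * A ^ 2 = A := by
    simpa using congrArg (Polynomial.aeval A) hqr
  refine ⟨Polynomial.aeval A q, key, ?_⟩
  have hcomm : Commute A (Polynomial.aeval A q) := by
    simpa only [map_mul, Polynomial.aeval_X, commute_iff_eq] using
      congrArg (Polynomial.aeval A) (mul_comm Polynomial.X q)
  rw [(hcomm.pow_left 2).eq, key]

/-- The projection of a module onto the `ζ`-eigenspace of an endomorphism `θ` with `θ ^ m = 1`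
and `ζ ^ m = 1`. -/
noncomputable def eigenprojection {K V : Type*} [Field K] [AddCommGroup V] [Module K V]
    (θ : Module.End K V) (m : ℕ) (ζ : K) : Module.End K V :=
  (m : K)⁻¹ • ∑ k ∈ Finset.range m, (ζ⁻¹ • θ) ^ k

section eigenprojection

variable {K V : Type*} [Field K] [AddCommGroup V] [Module K V] {θ : Module.End K V} {m : ℕ}
  {ζ : K}

theorem eigenprojection_apply_mem (hθ : θ ^ m = 1) (hζ : ζ ^ m = 1) (hζ0 : ζ ≠ 0) (x : V) :
    eigenprojection θ m ζ x ∈ θ.eigenspace ζ := by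
  have h : (ζ⁻¹ • θ - 1) * eigenprojection θ m ζ = 0 := by
    rw [eigenprojection, mul_smul_comm, mul_geom_sum, smul_pow, hθ, inv_pow, hζ]
    simp
  have hx := LinearMap.congr_fun h x
  simp only [Module.End.mul_apply, LinearMap.sub_apply, LinearMap.smul_apply,
    Module.End.one_apply, LinearMap.zero_apply, sub_eq_zero] at hx
  rw [Module.End.mem_eigenspace_iff]
  exact (inv_smul_eq_iff₀ hζ0).mp hx

theorem eigenprojection_apply_of_mem (hm : (m : K) ≠ 0) (hζ0 : ζ ≠ 0) {x : V}
    (hx : x ∈ θ.eigenspace ζ) : eigenprojection θ m ζ x = x := by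
  rw [Module.End.mem_eigenspace_iff] at hx
  have hk (k : ℕ) : ((ζ⁻¹ • θ) ^ k) x = x := by
    induction k with
    | zero => simp
    | succ k ih => simp [pow_succ, hx, smul_smul, hζ0, ih]
  simp [eigenprojection, hk, ← Nat.cast_smul_eq_nsmul K, smul_smul, hm]

theorem eigenprojection_mul {A : Module.End K V} {ξ : K} (hξ0 : ξ ≠ 0)
    (hA : θ * A = ξ • (A * θ)) :
    eigenprojection θ m (ζ * ξ) * A = A * eigenprojection θ m ζ := by
  have h : SemiconjBy A (ζ⁻¹ • θ) ((ζ * ξ)⁻¹ • θ) := by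
    rw [SemiconjBy, smul_mul_assoc, hA, mul_smul_comm, smul_smul, mul_inv, mul_assoc,
      inv_mul_cancel₀ hξ0, mul_one]
  simp only [eigenprojection, smul_mul_assoc, mul_smul_comm, Finset.sum_mul, Finset.mul_sum]
  exact congrArg _ (Finset.sum_congr rfl fun k _ => (h.pow_right k).eq.symm)

end eigenprojection

theorem LaurentPolynomial.tensor_induction {K V : Type*} [CommRing K] [AddCommGroup V]
    [Module K V] {P : LaurentPolynomial K ⊗[K] V → Prop}
    (tmul : ∀ (n : ℤ) (x : V), P (T n ⊗ₜ[K] x)) (add : ∀ v w, P v → P w → P (v + w))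
    (v : LaurentPolynomial K ⊗[K] V) : P v := by
  induction v with
  | zero => simpa using tmul 0 0
  | add v w hv hw => exact add v w hv hw
  | tmul f x =>
    induction f using LaurentPolynomial.induction_on' with
    | add f₁ f₂ h₁ h₂ => rw [TensorProduct.add_tmul]; exact add _ _ h₁ h₂
    | C_mul_T n c =>
      rw [← LaurentPolynomial.smul_eq_C_mul, TensorProduct.smul_tmul]
      exact tmul n (c • x)

section loop

variable {g : Type*} [LieRing g] [LieAlgebra ℂ g]

theorem ad_T_tmul (i n : ℤ) (X x : g) :
    LieAlgebra.ad ℂ (LaurentPolynomial ℂ ⊗[ℂ] g) (T i ⊗ₜ[ℂ] X) (T n ⊗ₜ[ℂ] x) =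
      T (i + n) ⊗ₜ[ℂ] ⁅X, x⁆ := by
  rw [LieAlgebra.ad_apply, LieAlgebra.ExtendScalars.bracket_tmul, ← T_add]

/-- The form `δ_{i,-j} κ(x,y)` is invariant under `ad (T i ⊗ X)`. -/
theorem loop_form_ad_left
    (B : (LaurentPolynomial ℂ ⊗[ℂ] g) →ₗ[ℂ] (LaurentPolynomial ℂ ⊗[ℂ] g) →ₗ[ℂ] ℂ)
    (hB : ∀ (i j : ℤ) (x y : g),
      B (T i ⊗ₜ[ℂ] x) (T j ⊗ₜ[ℂ] y) = if i + j = 0 then killingForm ℂ g x y else 0)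
    (i : ℤ) (X : g) (v w : LaurentPolynomial ℂ ⊗[ℂ] g) :
    B (LieAlgebra.ad ℂ (LaurentPolynomial ℂ ⊗[ℂ] g) (T i ⊗ₜ[ℂ] X) v) w =
      -B v (LieAlgebra.ad ℂ (LaurentPolynomial ℂ ⊗[ℂ] g) (T i ⊗ₜ[ℂ] X) w) := by
  induction v using LaurentPolynomial.tensor_induction with
  | add v₁ v₂ h₁ h₂ => simp only [map_add, LinearMap.add_apply, h₁, h₂, neg_add]
  | tmul n x =>
    induction w using LaurentPolynomial.tensor_induction with
    | add w₁ w₂ h₁ h₂ => simp only [map_add, h₁, h₂, neg_add]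
    | tmul k y =>
      rw [ad_T_tmul, ad_T_tmul, hB, hB, show n + (i + k) = i + n + k by ring]
      split_ifs
      · exact LieModule.traceForm_apply_lie_apply' ℂ g g X x y
      · simp

/-- If `ad X` is semisimple, then `ad (T i ⊗ X)` has the same kernel as its square. -/
theorem ad_T_tmul_apply_eq_zero [Module.Finite ℂ g] {X : g}
    (hX : (LieAlgebra.ad ℂ g X).IsSemisimple) {i : ℤ} {v : LaurentPolynomial ℂ ⊗[ℂ] g}
    (hv : LieAlgebra.ad ℂ (LaurentPolynomial ℂ ⊗[ℂ] g) (T i ⊗ₜ[ℂ] X)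
      (LieAlgebra.ad ℂ (LaurentPolynomial ℂ ⊗[ℂ] g) (T i ⊗ₜ[ℂ] X) v) = 0) :
    LieAlgebra.ad ℂ (LaurentPolynomial ℂ ⊗[ℂ] g) (T i ⊗ₜ[ℂ] X) v = 0 := by
  obtain ⟨C, hC, -⟩ := hX.exists_sq_mul_eq
  have hinv (w : LaurentPolynomial ℂ ⊗[ℂ] g) :
      TensorProduct.map (LinearMap.mulLeft ℂ (T (-i) : LaurentPolynomial ℂ)) C
        (LieAlgebra.ad ℂ (LaurentPolynomial ℂ ⊗[ℂ] g) (T i ⊗ₜ[ℂ] X)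
          (LieAlgebra.ad ℂ (LaurentPolynomial ℂ ⊗[ℂ] g) (T i ⊗ₜ[ℂ] X) w)) =
      LieAlgebra.ad ℂ (LaurentPolynomial ℂ ⊗[ℂ] g) (T i ⊗ₜ[ℂ] X) w := by
    induction w using LaurentPolynomial.tensor_induction with
    | add w₁ w₂ h₁ h₂ => simp only [map_add, h₁, h₂]
    | tmul n x =>
      have hx : C ⁅X, ⁅X, x⁆⁆ = ⁅X, x⁆ := by
        simpa [pow_two] using LinearMap.congr_fun hC x
      rw [ad_T_tmul, ad_T_tmul, TensorProduct.map_tmul, hx, LinearMap.mulLeft_apply, ← T_add,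
        neg_add_cancel_left]
  rw [← hinv v, hv, map_zero]

end loop

/-- With `g(θ,m) = ⊕ᵢ uⁱ ⊗ g_{i mod m}` inside the loop algebra
`L = ℂ[u,u⁻¹] ⊗ g`, and `p = u ⊗ X` for a regular semisimple `X ∈ g₁`, the graded
Lie algebra `g(θ,m)` decomposes orthogonally (for the form
`⟨uⁱ⊗x, uʲ⊗y⟩ = δ_{i,-j} κ(x,y)`) as `a ⊕ c`, where `a = ker (ad p) ⊓ g(θ,m)` and
`c = ⁅p, g(θ,m)⁆`. -/
theorem loop_algebra_orthogonal_decomposition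
    (g : Type*) [LieRing g] [LieAlgebra ℂ g] [Module.Finite ℂ g]
    [LieAlgebra.IsSemisimple ℂ g]
    (m : ℕ) (hm : 0 < m)
    (ξ : ℂ) (hξ : ξ = Complex.exp (2 * Real.pi * Complex.I / m))
    (θ : Module.End ℂ g) (hθlie : ∀ x y : g, θ ⁅x, y⁆ = ⁅θ x, θ y⁆)
    (hθm : θ ^ m = 1)
    (gi : ℤ → Submodule ℂ g)
    (hgi : ∀ i : ℤ, gi i = Module.End.eigenspace θ (ξ ^ i))
    (B : (LaurentPolynomial ℂ ⊗[ℂ] g) →ₗ[ℂ] (LaurentPolynomial ℂ ⊗[ℂ] g) →ₗ[ℂ] ℂ)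
    (hB : ∀ (i j : ℤ) (x y : g),
      B (T i ⊗ₜ[ℂ] x) (T j ⊗ₜ[ℂ] y) = if i + j = 0 then killingForm ℂ g x y else 0)
    (piece : ℤ → Submodule ℂ (LaurentPolynomial ℂ ⊗[ℂ] g))
    (hpiece : ∀ n : ℤ,
      piece n = (gi n).map (TensorProduct.mk ℂ (LaurentPolynomial ℂ) g (T n)))
    (gθ : Submodule ℂ (LaurentPolynomial ℂ ⊗[ℂ] g)) (hgθ : gθ = ⨆ n : ℤ, piece n)
    (X : g) (hX : X ∈ gi 1)
    (hss : (LieAlgebra.ad ℂ g X).IsSemisimple)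
    (hCartan : (centralizerSubalgebra ℂ g X).IsCartanSubalgebra)
    (p : LaurentPolynomial ℂ ⊗[ℂ] g) (hp : p = T 1 ⊗ₜ[ℂ] X)
    (a c : Submodule ℂ (LaurentPolynomial ℂ ⊗[ℂ] g))
    (ha : a = gθ ⊓ LinearMap.ker (LieAlgebra.ad ℂ (LaurentPolynomial ℂ ⊗[ℂ] g) p))
    (hc : c = Submodule.map (LieAlgebra.ad ℂ (LaurentPolynomial ℂ ⊗[ℂ] g) p) gθ) :
    c ≤ gθ ∧ a ⊔ c = gθ ∧ a ⊓ c = ⊥ ∧ (∀ v ∈ a, ∀ w ∈ c, B v w = 0) := by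
  have hm0 : (m : ℂ) ≠ 0 := Nat.cast_ne_zero.mpr hm.ne'
  have hξ0 : ξ ≠ 0 := hξ ▸ Complex.exp_ne_zero _
  have hξm : ξ ^ m = 1 := hξ ▸ (Complex.isPrimitiveRoot_exp m hm.ne').pow_eq_one
  have hξn0 (n : ℤ) : ξ ^ n ≠ 0 := zpow_ne_zero n hξ0
  have hξnm (n : ℤ) : (ξ ^ n) ^ m = 1 := by
    rw [← zpow_natCast, zpow_comm, zpow_natCast, hξm, one_zpow]
  have hθX : θ X = ξ • X := by
    rw [hgi, zpow_one, Module.End.mem_eigenspace_iff] at hX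
    exact hX
  have hcomm : θ * LieAlgebra.ad ℂ g X = ξ • (LieAlgebra.ad ℂ g X * θ) := by
    ext x
    simp [hθlie, hθX]
  have hproj (n : ℤ) (x : g) :
      eigenprojection θ m (ξ ^ (n + 1)) ⁅X, x⁆ = ⁅X, eigenprojection θ m (ξ ^ n) x⁆ := by
    rw [zpow_add_one₀ hξ0]
    exact LinearMap.congr_fun (eigenprojection_mul hξ0 hcomm) x
  have hmem (n : ℤ) (x : g) : eigenprojection θ m (ξ ^ n) x ∈ gi n :=
    hgi n ▸ eigenprojection_apply_mem hθm (hξnm n) (hξn0 n) x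
  have hfix (n : ℤ) {x : g} (hx : x ∈ gi n) : eigenprojection θ m (ξ ^ n) x = x :=
    eigenprojection_apply_of_mem hm0 (hξn0 n) (hgi n ▸ hx)
  have hT (n : ℤ) {x : g} (hx : x ∈ gi n) : T n ⊗ₜ[ℂ] x ∈ gθ := by
    rw [hgθ]
    refine Submodule.mem_iSup_of_mem n ?_
    rw [hpiece]
    exact ⟨x, hx, rfl⟩
  have hle (S : Submodule ℂ (LaurentPolynomial ℂ ⊗[ℂ] g))
      (h : ∀ (n : ℤ) (x : g), x ∈ gi n → T n ⊗ₜ[ℂ] x ∈ S) : gθ ≤ S := by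
    rw [hgθ]
    refine iSup_le fun n => ?_
    rw [hpiece]
    rintro _ ⟨x, hx, rfl⟩
    exact h n x hx
  subst hp ha hc
  have hcle : Submodule.map (LieAlgebra.ad ℂ (LaurentPolynomial ℂ ⊗[ℂ] g) (T 1 ⊗ₜ[ℂ] X)) gθ
      ≤ gθ := by
    rw [Submodule.map_le_iff_le_comap]
    refine hle _ fun n x hx => ?_
    rw [Submodule.mem_comap, ad_T_tmul, add_comm]
    refine hT _ ?_
    rw [← hfix n hx, ← hproj]
    exact hmem _ _
  refine ⟨hcle, le_antisymm (sup_le inf_le_left hcle) (hle _ fun n x hx => ?_), ?_, ?_⟩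
  · obtain ⟨C, -, hC⟩ := hss.exists_sq_mul_eq
    obtain ⟨n, rfl⟩ : ∃ k, n = k + 1 := ⟨n - 1, by ring⟩
    have hker : ⁅X, x - ⁅X, C x⁆⁆ = 0 := by
      have := LinearMap.congr_fun hC x
      simp only [pow_two, Module.End.mul_apply, LieAlgebra.ad_apply] at this
      rw [lie_sub, this, sub_self]
    have hsplit : x = eigenprojection θ m (ξ ^ (n + 1)) (x - ⁅X, C x⁆) +
        ⁅X, eigenprojection θ m (ξ ^ n) (C x)⁆ := by
      rw [← hproj, ← map_add, sub_add_cancel, hfix _ hx]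
    rw [hsplit, TensorProduct.tmul_add]
    refine Submodule.add_mem_sup ⟨hT _ (hmem _ _), ?_⟩
      ⟨T n ⊗ₜ[ℂ] eigenprojection θ m (ξ ^ n) (C x), hT _ (hmem _ _), ?_⟩
    · rw [SetLike.mem_coe, LinearMap.mem_ker, ad_T_tmul, ← hproj, hker, map_zero,
        TensorProduct.tmul_zero]
    · rw [ad_T_tmul, add_comm]
  · rw [eq_bot_iff]
    rintro _ ⟨⟨-, hv⟩, w, -, rfl⟩
    exact ad_T_tmul_apply_eq_zero hss hv
  · rintro v ⟨-, hv⟩ _ ⟨w, -, rfl⟩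
    have hinv := loop_form_ad_left B hB 1 X v w
    rw [LinearMap.mem_ker.mp hv, map_zero, LinearMap.zero_apply, zero_eq_neg] at hinv
    exact hinv
end

section
/- Let g be a finite-dimensional semisimple Lie algebra over ℂ with Killing form κ, θ an automorphism of g with θ^m = id, ξ_m = exp(2πi/m), and g_i the ξ_m^i-eigenspace of θ. Let L := ℂ[u,u⁻¹] ⊗_ℂ g, g(θ,m) := ⊕_{i∈ℤ} u^i ⊗ g_{i mod m} with graded pieces g(θ,m)_i := u^i ⊗ g_{i mod m}, and let ⟨·,·⟩ be the bilinear form on L with ⟨u^i⊗x, u^j⊗y⟩ = δ_{i,-j}·κ(x,y). Let X ∈ g_1 be regular semisimple (ad X semisimple with ker(ad X) a Cartan subalgebra), p := u⊗X, and a := {ξ ∈ g(θ,m) : ⁅p, ξ⁆ = 0}. Then: (a) a is an abelian Lie subalgebra of g(θ,m); (b) a = ⊕_{i∈ℤ} a_i with a_i := a ∩ g(θ,m)_i; (c) ⟨a_i, a_j⟩ = 0 whenever i + j ≠ 0; (d) for each i, the pairing a_i × a_{-i} → ℂ given by ⟨·,·⟩ is nondegenerate. -/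
open TensorProduct LaurentPolynomial

/-- The coefficient of `Tⁿ` in an element of the loop algebra. -/
noncomputable def loopCoeff (g : Type*) [LieRing g] [LieAlgebra ℂ g] (n : ℤ) :
    LaurentPolynomial ℂ ⊗[ℂ] g →ₗ[ℂ] g :=
  TensorProduct.lift ((LinearMap.lsmul ℂ g).comp
    ((Finsupp.lapply n).comp (AddMonoidAlgebra.coeffLinearEquiv ℂ).toLinearMap))

section LoopCoeff

variable {g : Type*} [LieRing g] [LieAlgebra ℂ g]

theorem loopCoeff_T_tmul (n k : ℤ) (x : g) :
    loopCoeff g k ((T n : LaurentPolynomial ℂ) ⊗ₜ[ℂ] x) = if n = k then x else 0 := by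
  have h : (T n : LaurentPolynomial ℂ).coeff k = if n = k then 1 else 0 := by
    rw [T, AddMonoidAlgebra.coeff_single, Finsupp.single_apply]
  change (T n : LaurentPolynomial ℂ).coeff k • x = _
  rw [h]
  split_ifs <;> simp

/-- Homogeneous subspaces `Tⁿ ⊗ V n` of the loop algebra are independent. -/
theorem iSupIndep_map_T_tmul (V : ℤ → Submodule ℂ g) :
    iSupIndep fun n : ℤ =>
      (V n).map (TensorProduct.mk ℂ (LaurentPolynomial ℂ) g (T n)) := by
  intro n
  rw [Submodule.disjoint_def]
  rintro _ ⟨x, -, rfl⟩ hx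
  have hle : (⨆ j, ⨆ (_ : j ≠ n), (V j).map (TensorProduct.mk ℂ (LaurentPolynomial ℂ) g (T j))) ≤
      LinearMap.ker (loopCoeff g n) := by
    refine iSup₂_le fun j hj => ?_
    rintro _ ⟨y, -, rfl⟩
    simp [loopCoeff_T_tmul, hj]
  have h0 : x = 0 := by simpa [loopCoeff_T_tmul] using hle hx
  simp [h0]

/-- If a sum of homogeneous elements commutes with `T ⊗ X`, then so does each summand. -/
theorem lie_coeff_eq_zero_of_lie_sum_eq_zero (X : g) (s : Finset ℤ) (x : ℤ → g)
    (h : ⁅(T 1 : LaurentPolynomial ℂ) ⊗ₜ[ℂ] X,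
      ∑ n ∈ s, (T n : LaurentPolynomial ℂ) ⊗ₜ[ℂ] x n⁆ = 0) {k : ℤ} (hk : k ∈ s) :
    ⁅X, x k⁆ = 0 := by
  have h' := congrArg (loopCoeff g (1 + k)) h
  rw [show ⁅(T 1 : LaurentPolynomial ℂ) ⊗ₜ[ℂ] X,
      ∑ n ∈ s, (T n : LaurentPolynomial ℂ) ⊗ₜ[ℂ] x n⁆ =
      ∑ n ∈ s, (T (1 + n) : LaurentPolynomial ℂ) ⊗ₜ[ℂ] ⁅X, x n⁆ from
      (lie_sum s (fun n => (T n : LaurentPolynomial ℂ) ⊗ₜ[ℂ] x n)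
        ((T 1 : LaurentPolynomial ℂ) ⊗ₜ[ℂ] X)).trans
        (Finset.sum_congr rfl fun n _ => by
          rw [T_add]; exact LieAlgebra.ExtendScalars.bracket_tmul ..)] at h'
  simp only [map_sum, loopCoeff_T_tmul, map_zero, add_right_inj] at h'
  simpa [hk] using h'

/-- If `T ⊗ X` commutes with `Tⁿ ⊗ x`, then `X` commutes with `x`. -/
theorem lie_eq_zero_of_lie_T_tmul_eq_zero (X : g) (n : ℤ) (x : g)
    (h : ⁅(T 1 : LaurentPolynomial ℂ) ⊗ₜ[ℂ] X, (T n : LaurentPolynomial ℂ) ⊗ₜ[ℂ] x⁆ = 0) :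
    ⁅X, x⁆ = 0 :=
  lie_coeff_eq_zero_of_lie_sum_eq_zero X {n} (fun _ => x) (by rwa [Finset.sum_singleton])
    (Finset.mem_singleton_self n)

/-- The centralizer of `T ⊗ X` in a graded subspace `⨁ Tⁿ ⊗ V n` is graded. -/
theorem iSup_inf_ker_ad_eq (X : g) (V : ℤ → Submodule ℂ g)
    (piece : ℤ → Submodule ℂ (LaurentPolynomial ℂ ⊗[ℂ] g))
    (hpiece : ∀ n, piece n = (V n).map (TensorProduct.mk ℂ (LaurentPolynomial ℂ) g (T n)))
    (a : Submodule ℂ (LaurentPolynomial ℂ ⊗[ℂ] g))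
    (ha : a = (⨆ n, piece n) ⊓
      LinearMap.ker (LieAlgebra.ad ℂ (LaurentPolynomial ℂ ⊗[ℂ] g) (T 1 ⊗ₜ[ℂ] X))) :
    a = ⨆ i : ℤ, (a ⊓ piece i) := by
  refine le_antisymm (fun v hv => ?_) (iSup_le fun i => inf_le_left)
  have hv' := hv
  rw [ha, Submodule.mem_inf, LinearMap.mem_ker, LieAlgebra.ad_apply] at hv'
  obtain ⟨hsup, hlie⟩ := hv'
  obtain ⟨f, hf, rfl⟩ := (Submodule.mem_iSup_iff_exists_finsupp _ _).mp hsup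
  have hex : ∀ n, ∃ x ∈ V n, (T n : LaurentPolynomial ℂ) ⊗ₜ[ℂ] x = f n := fun n => by
    have := hf n
    rwa [hpiece] at this
  choose x hxV hx using hex
  refine Submodule.sum_mem _ fun k hk => Submodule.mem_iSup_of_mem k ⟨?_, hf k⟩
  have hXk : ⁅X, x k⁆ = 0 := by
    refine lie_coeff_eq_zero_of_lie_sum_eq_zero X f.support x ?_ hk
    simpa only [hx, Finsupp.sum] using hlie
  rw [SetLike.mem_coe, ha, Submodule.mem_inf]
  refine ⟨Submodule.mem_iSup_of_mem k (hf k), ?_⟩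
  rw [LinearMap.mem_ker, LieAlgebra.ad_apply]
  simp only [← hx]
  rw [LieAlgebra.ExtendScalars.bracket_tmul, hXk, TensorProduct.tmul_zero]

end LoopCoeff

section FiniteOrder

variable {g : Type*} [LieRing g] [LieAlgebra ℂ g]

/-- The Killing form is invariant under Lie algebra endomorphisms of finite order. -/
theorem killingForm_apply_of_pow_eq_one {m : ℕ} (hm : 0 < m) (θ : Module.End ℂ g)
    (hθlie : ∀ x y : g, θ ⁅x, y⁆ = ⁅θ x, θ y⁆) (hθm : θ ^ m = 1) (x y : g) :
    killingForm ℂ g (θ x) (θ y) = killingForm ℂ g x y := by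
  have hbij : Function.Bijective θ :=
    (Module.End.isUnit_iff θ).mp (IsUnit.of_pow_eq_one hθm hm.ne')
  let e : g ≃ₗ⁅ℂ⁆ g := LieEquiv.ofBijective
    ({ θ with map_lie' := fun {x y} => hθlie x y } : g →ₗ⁅ℂ⁆ g) hbij
  exact LieAlgebra.killingForm_of_equiv_apply e x y

/-- The averaging projection onto the `ζ⁻¹`-eigenspace of an operator of finite order. -/
theorem sum_pow_smul_mem_eigenspace {V : Type*} [AddCommGroup V] [Module ℂ V]
    {m : ℕ} (θ : Module.End ℂ V) (hθm : θ ^ m = 1) {ζ : ℂ} (hζ0 : ζ ≠ 0) (hζ : ζ ^ m = 1)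
    (y : V) :
    ∑ k ∈ Finset.range m, ζ ^ k • (θ ^ k) y ∈ Module.End.eigenspace θ ζ⁻¹ := by
  rw [Module.End.mem_eigenspace_iff, map_sum, eq_inv_smul_iff₀ hζ0, Finset.smul_sum]
  have hstep : ∀ k, ζ • θ (ζ ^ k • (θ ^ k) y) = ζ ^ (k + 1) • (θ ^ (k + 1)) y := fun k => by
    rw [map_smul, smul_smul, pow_succ', pow_succ' θ, Module.End.mul_apply]
  simp only [hstep]
  have h1 := Finset.sum_range_succ (fun k => ζ ^ k • (θ ^ k) y) m
  rw [Finset.sum_range_succ'] at h1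
  simpa [hζ, hθm] using h1

/-- On a `θ`-stable subspace where the Killing form is nondegenerate, opposite eigenspaces of a
finite-order automorphism `θ` are nondegenerately paired. -/
theorem eq_zero_of_killingForm_eigenspace_eq_zero {m : ℕ} (hm : 0 < m) (θ : Module.End ℂ g)
    (hθlie : ∀ x y : g, θ ⁅x, y⁆ = ⁅θ x, θ y⁆) (hθm : θ ^ m = 1)
    (H : Submodule ℂ g) (hθH : ∀ y ∈ H, θ y ∈ H)
    (hH : ∀ x ∈ H, (∀ y ∈ H, killingForm ℂ g x y = 0) → x = 0)
    {ζ : ℂ} (hζ0 : ζ ≠ 0) (hζ : ζ ^ m = 1) {x : g} (hxH : x ∈ H)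
    (hx : x ∈ Module.End.eigenspace θ ζ)
    (hpair : ∀ y ∈ H, y ∈ Module.End.eigenspace θ ζ⁻¹ → killingForm ℂ g x y = 0) :
    x = 0 := by
  rw [Module.End.mem_eigenspace_iff] at hx
  refine hH x hxH fun y hy => ?_
  have hpowH : ∀ k, (θ ^ k) y ∈ H := by
    intro k
    induction k with
    | zero => simpa using hy
    | succ k ih => rw [pow_succ', Module.End.mul_apply]; exact hθH _ ih
  have hpow : ∀ k, ζ ^ k * killingForm ℂ g x ((θ ^ k) y) = killingForm ℂ g x y := by
    intro k
    induction k with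
    | zero => simp
    | succ k ih =>
      rw [← ih, ← killingForm_apply_of_pow_eq_one hm θ hθlie hθm x ((θ ^ k) y), hx,
        pow_succ' θ, Module.End.mul_apply, map_smul, LinearMap.smul_apply, smul_eq_mul]
      ring
  have h := hpair _ (H.sum_mem fun k _ => H.smul_mem (ζ ^ k) (hpowH k))
    (sum_pow_smul_mem_eigenspace θ hθm hζ0 hζ y)
  simp only [map_sum, map_smul, smul_eq_mul, hpow, Finset.sum_const, Finset.card_range,
    nsmul_eq_mul] at h
  exact (mul_eq_zero.mp h).resolve_left (Nat.cast_ne_zero.mpr hm.ne')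

end FiniteOrder

/-- With `g(θ,m) = ⊕ᵢ uⁱ ⊗ g_{i mod m}` inside the loop algebra
`L = ℂ[u,u⁻¹] ⊗ g`, and `p = u ⊗ X` for a regular semisimple `X ∈ g₁`, the
centralizer `a` of `p` in `g(θ,m)` is an abelian graded subalgebra `a = ⊕ᵢ aᵢ`
(`aᵢ = a ⊓ (uⁱ ⊗ g_{i mod m})`), whose graded pieces are orthogonal for
`⟨uⁱ⊗x, uʲ⊗y⟩ = δ_{i,-j} κ(x,y)` in degrees with `i + j ≠ 0` and nondegenerately
paired in complementary degrees. -/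
theorem loop_centralizer_abelian_graded_pairing
    (g : Type*) [LieRing g] [LieAlgebra ℂ g] [Module.Finite ℂ g]
    [LieAlgebra.IsSemisimple ℂ g]
    (m : ℕ) (hm : 0 < m)
    (ξ : ℂ) (hξ : ξ = Complex.exp (2 * Real.pi * Complex.I / m))
    (θ : Module.End ℂ g) (hθlie : ∀ x y : g, θ ⁅x, y⁆ = ⁅θ x, θ y⁆)
    (hθm : θ ^ m = 1)
    (gi : ℤ → Submodule ℂ g)
    (hgi : ∀ i : ℤ, gi i = Module.End.eigenspace θ (ξ ^ i))
    (B : (LaurentPolynomial ℂ ⊗[ℂ] g) →ₗ[ℂ] (LaurentPolynomial ℂ ⊗[ℂ] g) →ₗ[ℂ] ℂ)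
    (hB : ∀ (i j : ℤ) (x y : g),
      B (T i ⊗ₜ[ℂ] x) (T j ⊗ₜ[ℂ] y) = if i + j = 0 then killingForm ℂ g x y else 0)
    (piece : ℤ → Submodule ℂ (LaurentPolynomial ℂ ⊗[ℂ] g))
    (hpiece : ∀ n : ℤ,
      piece n = (gi n).map (TensorProduct.mk ℂ (LaurentPolynomial ℂ) g (T n)))
    (gθ : Submodule ℂ (LaurentPolynomial ℂ ⊗[ℂ] g)) (hgθ : gθ = ⨆ n : ℤ, piece n)
    (X : g) (hX : X ∈ gi 1)
    (hss : (LieAlgebra.ad ℂ g X).IsSemisimple)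
    (hCartan : (centralizerSubalgebra ℂ g X).IsCartanSubalgebra)
    (p : LaurentPolynomial ℂ ⊗[ℂ] g) (hp : p = T 1 ⊗ₜ[ℂ] X)
    (a : Submodule ℂ (LaurentPolynomial ℂ ⊗[ℂ] g))
    (ha : a = gθ ⊓ LinearMap.ker (LieAlgebra.ad ℂ (LaurentPolynomial ℂ ⊗[ℂ] g) p)) :
    (∀ v ∈ a, ∀ w ∈ a, ⁅v, w⁆ = 0) ∧
    (a = ⨆ i : ℤ, (a ⊓ piece i)) ∧
    (iSupIndep fun i : ℤ => a ⊓ piece i) ∧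
    (∀ i j : ℤ, i + j ≠ 0 →
        ∀ v ∈ a ⊓ piece i, ∀ w ∈ a ⊓ piece j, B v w = 0) ∧
    (∀ i : ℤ, ∀ v ∈ a ⊓ piece i,
        (∀ w ∈ a ⊓ piece (-i), B v w = 0) → v = 0) := by
  have hξ0 : ξ ≠ 0 := hξ ▸ Complex.exp_ne_zero _
  have hξm : ξ ^ m = 1 := hξ ▸ (Complex.isPrimitiveRoot_exp m hm.ne').pow_eq_one
  set H := centralizerSubalgebra ℂ g X
  have hHab : ∀ x y : g, ⁅X, x⁆ = 0 → ⁅X, y⁆ = 0 → ⁅x, y⁆ = 0 := fun x y hx hy =>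
    congrArg Subtype.val (trivial_lie_zero H H ⟨x, hx⟩ ⟨y, hy⟩)
  have hHnd : ∀ x ∈ H.toSubmodule,
      (∀ y ∈ H.toSubmodule, killingForm ℂ g x y = 0) → x = 0 := by
    intro x hx h
    have hker : (⟨x, hx⟩ : H) ∈ LinearMap.ker ((killingForm ℂ g).restrict H) := by
      rw [LinearMap.mem_ker]
      ext y
      exact h y.1 y.2
    rw [LieAlgebra.IsKilling.ker_restrict_eq_bot_of_isCartanSubalgebra] at hker
    exact congrArg Subtype.val ((Submodule.mem_bot ℂ).mp hker)
  have hθX : θ X = ξ • X := by simpa [hgi, Module.End.mem_eigenspace_iff] using hX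
  have hθH : ∀ y ∈ H.toSubmodule, θ y ∈ H.toSubmodule := by
    intro y hy
    have h := hθlie X y
    rw [show ⁅X, y⁆ = 0 from hy, map_zero, hθX, smul_lie] at h
    exact (smul_eq_zero.mp h.symm).resolve_left hξ0
  subst hp hgθ
  have hdecomp := iSup_inf_ker_ad_eq X gi piece hpiece a ha
  have hmem : ∀ i, ∀ v ∈ a ⊓ piece i, ∃ x ∈ gi i, ⁅X, x⁆ = 0 ∧ T i ⊗ₜ[ℂ] x = v := by
    rintro i v ⟨hva, hvi⟩
    rw [SetLike.mem_coe, hpiece] at hvi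
    obtain ⟨x, hx, rfl⟩ := hvi
    rw [SetLike.mem_coe, ha] at hva
    exact ⟨x, hx, lie_eq_zero_of_lie_T_tmul_eq_zero X i x hva.2, rfl⟩
  have hmem' : ∀ i, ∀ x ∈ gi i, ⁅X, x⁆ = 0 → T i ⊗ₜ[ℂ] x ∈ a ⊓ piece i := by
    intro i x hx hXx
    have hp : T i ⊗ₜ[ℂ] x ∈ piece i := by
      rw [hpiece]
      exact ⟨x, hx, rfl⟩
    refine ⟨?_, hp⟩
    rw [SetLike.mem_coe, ha, Submodule.mem_inf, LinearMap.mem_ker, LieAlgebra.ad_apply,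
      LieAlgebra.ExtendScalars.bracket_tmul, hXx, TensorProduct.tmul_zero]
    exact ⟨Submodule.mem_iSup_of_mem i hp, rfl⟩
  refine ⟨?_, hdecomp, ?_, ?_, ?_⟩
  · intro v hv w hw
    rw [hdecomp] at hv hw
    induction hv using Submodule.iSup_induction' with
    | zero => exact zero_lie w
    | add v v' _ _ hv hv' => exact (add_lie v v' w).trans (by rw [hv, hv', add_zero])
    | mem i v hv =>
      induction hw using Submodule.iSup_induction' with
      | zero => exact lie_zero v
      | add w w' _ _ hw hw' => exact (lie_add v w w').trans (by rw [hw, hw', add_zero])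
      | mem j w hw =>
        obtain ⟨x, -, hx, rfl⟩ := hmem i v hv
        obtain ⟨y, -, hy, rfl⟩ := hmem j w hw
        rw [LieAlgebra.ExtendScalars.bracket_tmul, hHab x y hx hy, TensorProduct.tmul_zero]
  · refine iSupIndep.mono (iSupIndep_map_T_tmul gi) fun i => ?_
    rw [← hpiece]
    exact inf_le_right
  · intro i j hij v hv w hw
    obtain ⟨x, -, -, rfl⟩ := hmem i v hv
    obtain ⟨y, -, -, rfl⟩ := hmem j w hw
    rw [hB, if_neg hij]
  · intro i v hv h
    obtain ⟨x, hxi, hx, rfl⟩ := hmem i v hv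
    have hζ : (ξ ^ i) ^ m = 1 := by
      rw [← zpow_natCast, zpow_comm, zpow_natCast, hξm, one_zpow]
    have hx0 : x = 0 := by
      refine eq_zero_of_killingForm_eigenspace_eq_zero hm θ hθlie hθm H.toSubmodule hθH hHnd
        (zpow_ne_zero i hξ0) hζ hx (hgi i ▸ hxi) fun y hy hyi => ?_
      have hyi' : y ∈ gi (-i) := by rwa [hgi, zpow_neg]
      simpa [hB] using h _ (hmem' (-i) y hyi' hy)
    rw [hx0, TensorProduct.tmul_zero]
end

section
/- Let g be a finite-dimensional semisimple Lie algebra over ℂ with Killing form κ, equipped with a ℤ-grading g = ⊕_{k∈ℤ} g(k) (so ⁅g(k), g(l)⁆ ⊆ g(k+l)). Let m be a positive integer, ξ_m = exp(2πi/m), let θ be the automorphism of g acting on g(k) as multiplication by ξ_m^k, and let g_i = ⊕_{k ≡ i (mod m)} g(k) be its ξ_m^i-eigenspace. Let L := ℂ[u,u⁻¹] ⊗_ℂ g with form ⟨u^i⊗x, u^j⊗y⟩ = δ_{i,-j}·κ(x,y), and g(θ,m) := ⊕_{i∈ℤ} u^i ⊗ g_{i mod m}. Define Φ : L → L as the ℂ-linear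 map with Φ(u^i⊗v) = u^{i-k}⊗v for v ∈ g(k). Then: (a) Φ is a Lie algebra automorphism of L; (b) Φ preserves the form ⟨·,·⟩; (c) Φ restricts to a Lie algebra isomorphism from g(θ,m) onto g ⊗ ℂ[u^m, u^{-m}] (the Laurent polynomials in u^m with coefficients in g); (d) if moreover λ̌ ∈ g(0) satisfies ⁅λ̌, v⁆ = k·v for all v ∈ g(k), and δ : L → L is the derivation with δ(u^i⊗x) = i·u^i⊗x, then Φ ∘ δ = (δ + ad(1⊗λ̌)) ∘ Φ. -/
open TensorProduct LaurentPolynomial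

/-- Induction on `ℂ[u,u⁻¹] ⊗ g` along homogeneous pure tensors `uⁱ ⊗ v` with `v ∈ V k`. -/
theorem laurent_tensor_induction {g ι : Type*} [AddCommGroup g] [Module ℂ g]
    {V : ι → Submodule ℂ g} (hV : ⨆ k, V k = ⊤)
    {p : LaurentPolynomial ℂ ⊗[ℂ] g → Prop} (zero : p 0)
    (add : ∀ x y, p x → p y → p (x + y))
    (tmul : ∀ (i : ℤ) (k : ι), ∀ v ∈ V k, p (T i ⊗ₜ[ℂ] v)) (x : LaurentPolynomial ℂ ⊗[ℂ] g) :
    p x := by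
  have key : ∀ (i : ℤ) (v : g), p (T i ⊗ₜ[ℂ] v) := fun i v => by
    have hv : v ∈ ⨆ k, V k := hV ▸ Submodule.mem_top
    induction hv using Submodule.iSup_induction' with
    | mem k v hv => exact tmul i k v hv
    | zero => simpa using zero
    | add v w _ _ h₁ h₂ => simpa [TensorProduct.tmul_add] using add _ _ h₁ h₂
  induction x using TensorProduct.induction_on with
  | zero => exact zero
  | add x y hx hy => exact add x y hx hy
  | tmul a v =>
    induction a using LaurentPolynomial.induction_on' with
    | add a b ha hb => simpa [TensorProduct.add_tmul] using add _ _ ha hb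
    | C_mul_T i c =>
      rw [← LaurentPolynomial.smul_eq_C_mul, TensorProduct.smul_tmul]
      exact key i _

/-- The degree shift `uⁱ ⊗ v ↦ u^{i+k} ⊗ v` for `v ∈ V k` is realised by a linear map. -/
theorem exists_laurent_tensor_shift {g : Type*} [AddCommGroup g] [Module ℂ g]
    {V : ℤ → Submodule ℂ g} (hV : DirectSum.IsInternal V) :
    ∃ Ψ : (LaurentPolynomial ℂ ⊗[ℂ] g) →ₗ[ℂ] (LaurentPolynomial ℂ ⊗[ℂ] g),
      ∀ (i k : ℤ), ∀ v ∈ V k, Ψ (T i ⊗ₜ[ℂ] v) = T (i + k) ⊗ₜ[ℂ] v := by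
  let e := LinearEquiv.ofBijective (DirectSum.coeLinearMap V) hV
  let F : (DirectSum ℤ fun k => V k) →ₗ[ℂ]
      LaurentPolynomial ℂ →ₗ[ℂ] LaurentPolynomial ℂ ⊗[ℂ] g :=
    DirectSum.toModule ℂ ℤ _ fun k =>
      (LinearMap.lcomp ℂ _ (LinearMap.mulRight ℂ (T k))).comp
        ((TensorProduct.mk ℂ (LaurentPolynomial ℂ) g).flip.comp (V k).subtype)
  refine ⟨TensorProduct.lift (F.comp e.symm.toLinearMap).flip, fun i k v hv => ?_⟩
  have he : e.symm v = DirectSum.lof ℂ ℤ (fun k => V k) k ⟨v, hv⟩ := by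
    rw [LinearEquiv.symm_apply_eq]
    exact (DirectSum.coeAddMonoidHom_of V k ⟨v, hv⟩).symm
  simp only [TensorProduct.lift.tmul, LinearMap.flip_apply, LinearMap.comp_apply,
    LinearEquiv.coe_coe, he, F, DirectSum.toModule_lof, LinearMap.lcomp_apply,
    LinearMap.mulRight_apply, Submodule.subtype_apply, TensorProduct.mk_apply, ← T_add]

/-- If `lam` acts on `x` and `y` by scalars with nonzero sum, then `x` and `y` are orthogonal
for the Killing form. -/
theorem killingForm_eq_zero_of_lie_eq_smul {K g : Type*} [Field K] [LieRing g] [LieAlgebra K g]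
    {lam x y : g} {a b : K} (hx : ⁅lam, x⁆ = a • x) (hy : ⁅lam, y⁆ = b • y) (hab : a + b ≠ 0) :
    killingForm K g x y = 0 := by
  have h := LieModule.traceForm_apply_lie_apply K g g x lam y
  rw [← lie_skew, hx, hy] at h
  simp only [map_neg, map_smul, LinearMap.neg_apply, LinearMap.smul_apply, smul_eq_mul] at h
  exact (mul_eq_zero.mp (by linear_combination -h : (a + b) * killingForm K g x y = 0)).resolve_left
    hab

/-- Kac's isomorphism, inner case: Let `g = ⊕ₖ g(k)` be a ℤ-graded
finite-dimensional complex semisimple Lie algebra, `θ` the automorphism acting on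
`g(k)` by `ξ_m^k` with eigenspaces `gᵢ = ⊕_{k ≡ i (m)} g(k)`, and let
`Φ : ℂ[u,u⁻¹] ⊗ g → ℂ[u,u⁻¹] ⊗ g` be the linear map with `Φ(uⁱ ⊗ v) = u^{i-k} ⊗ v`
for `v ∈ g(k)`. Then (a) `Φ` is a Lie algebra automorphism; (b) `Φ` preserves the
form `⟨uⁱ⊗x, uʲ⊗y⟩ = δ_{i,-j} κ(x,y)`; (c) `Φ` maps `g(θ,m) = ⊕ᵢ uⁱ ⊗ g_{i mod m}`
onto `g ⊗ ℂ[uᵐ, u⁻ᵐ]`; (d) if `λ̌ ∈ g(0)` satisfies `⁅λ̌, v⁆ = k·v` on `g(k)` and `δ`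
is the derivation `δ(uⁱ⊗x) = i·uⁱ⊗x`, then `Φ ∘ δ = (δ + ad(1 ⊗ λ̌)) ∘ Φ`. -/
theorem kac_isomorphism_inner_case
    (g : Type*) [LieRing g] [LieAlgebra ℂ g] [Module.Finite ℂ g]
    [LieAlgebra.IsSemisimple ℂ g]
    (m : ℕ) (hm : 0 < m)
    (V : ℤ → Submodule ℂ g) (hV : DirectSum.IsInternal V)
    (hbr : ∀ k l : ℤ, ∀ x ∈ V k, ∀ y ∈ V l, ⁅x, y⁆ ∈ V (k + l))
    (gi : ℤ → Submodule ℂ g)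
    (hgi : ∀ n : ℤ, gi n = ⨆ k : ℤ, ⨆ _ : (m : ℤ) ∣ (k - n), V k)
    (B : (LaurentPolynomial ℂ ⊗[ℂ] g) →ₗ[ℂ] (LaurentPolynomial ℂ ⊗[ℂ] g) →ₗ[ℂ] ℂ)
    (hB : ∀ (i j : ℤ) (x y : g),
      B (T i ⊗ₜ[ℂ] x) (T j ⊗ₜ[ℂ] y) = if i + j = 0 then killingForm ℂ g x y else 0)
    (piece : ℤ → Submodule ℂ (LaurentPolynomial ℂ ⊗[ℂ] g))
    (hpiece : ∀ n : ℤ,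
      piece n = (gi n).map (TensorProduct.mk ℂ (LaurentPolynomial ℂ) g (T n)))
    (gθ : Submodule ℂ (LaurentPolynomial ℂ ⊗[ℂ] g)) (hgθ : gθ = ⨆ n : ℤ, piece n)
    (Φ : (LaurentPolynomial ℂ ⊗[ℂ] g) →ₗ[ℂ] (LaurentPolynomial ℂ ⊗[ℂ] g))
    (hΦ : ∀ (i k : ℤ), ∀ v ∈ V k, Φ (T i ⊗ₜ[ℂ] v) = T (i - k) ⊗ₜ[ℂ] v)
    (lam : g) (hlam : lam ∈ V 0)
    (hlam' : ∀ k : ℤ, ∀ v ∈ V k, ⁅lam, v⁆ = (k : ℂ) • v)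
    (δ : (LaurentPolynomial ℂ ⊗[ℂ] g) →ₗ[ℂ] (LaurentPolynomial ℂ ⊗[ℂ] g))
    (hδ : ∀ (i : ℤ) (x : g), δ (T i ⊗ₜ[ℂ] x) = (i : ℂ) • (T i ⊗ₜ[ℂ] x)) :
    (Function.Bijective Φ ∧
      ∀ x y : LaurentPolynomial ℂ ⊗[ℂ] g, Φ ⁅x, y⁆ = ⁅Φ x, Φ y⁆) ∧
    (∀ v w : LaurentPolynomial ℂ ⊗[ℂ] g, B (Φ v) (Φ w) = B v w) ∧
    (Submodule.map Φ gθ =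
      ⨆ n : ℤ, Submodule.map (TensorProduct.mk ℂ (LaurentPolynomial ℂ) g (T (m * n)))
        (⊤ : Submodule ℂ g)) ∧
    (∀ v : LaurentPolynomial ℂ ⊗[ℂ] g,
      Φ (δ v) = δ (Φ v) + ⁅(1 : LaurentPolynomial ℂ) ⊗ₜ[ℂ] lam, Φ v⁆) := by
  have lie_zero' (x : LaurentPolynomial ℂ ⊗[ℂ] g) : ⁅x, (0 : LaurentPolynomial ℂ ⊗[ℂ] g)⁆ = 0 :=
    lie_zero x
  have zero_lie' (x : LaurentPolynomial ℂ ⊗[ℂ] g) : ⁅(0 : LaurentPolynomial ℂ ⊗[ℂ] g), x⁆ = 0 :=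
    zero_lie x
  have lie_add' (x y z : LaurentPolynomial ℂ ⊗[ℂ] g) : ⁅x, y + z⁆ = ⁅x, y⁆ + ⁅x, z⁆ :=
    lie_add x y z
  have add_lie' (x y z : LaurentPolynomial ℂ ⊗[ℂ] g) : ⁅x + y, z⁆ = ⁅x, z⁆ + ⁅y, z⁆ :=
    add_lie x y z
  have hsup := hV.submodule_iSup_eq_top
  have hbij : Function.Bijective Φ := by
    obtain ⟨Ψ, hΨ⟩ := exists_laurent_tensor_shift hV
    refine Function.bijective_iff_has_inverse.mpr ⟨Ψ, fun x => ?_, fun x => ?_⟩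
    · induction x using laurent_tensor_induction hsup with
      | zero => simp
      | add x y hx hy => simp [hx, hy]
      | tmul i k v hv => simp [hΦ i k v hv, hΨ _ k v hv]
    · induction x using laurent_tensor_induction hsup with
      | zero => simp
      | add x y hx hy => simp [hx, hy]
      | tmul i k v hv => simp [hΨ i k v hv, hΦ _ k v hv]
  refine ⟨⟨hbij, fun x y => ?_⟩, fun x y => ?_, le_antisymm ?_ ?_, fun x => ?_⟩
  · induction x using laurent_tensor_induction hsup with
    | zero => simp [zero_lie']
    | add x x' hx hx' => simp [add_lie', hx, hx']
    | tmul i k v hv =>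
      induction y using laurent_tensor_induction hsup with
      | zero => simp [lie_zero']
      | add y y' hy hy' => simp [lie_add', hy, hy']
      | tmul j l w hw =>
        rw [hΦ i k v hv, hΦ j l w hw, LieAlgebra.ExtendScalars.bracket_tmul,
          LieAlgebra.ExtendScalars.bracket_tmul, ← T_add, ← T_add,
          hΦ _ _ _ (hbr k l v hv w hw), add_sub_add_comm]
  · induction x using laurent_tensor_induction hsup with
    | zero => simp
    | add x x' hx hx' => simp [hx, hx']
    | tmul i k v hv =>
      induction y using laurent_tensor_induction hsup with
      | zero => simp
      | add y y' hy hy' => simp [hy, hy']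
      | tmul j l w hw =>
        rw [hΦ i k v hv, hΦ j l w hw, hB, hB]
        by_cases hkl : k + l = 0
        · rw [← add_sub_add_comm, hkl, sub_zero]
        · rw [killingForm_eq_zero_of_lie_eq_smul (hlam' k v hv) (hlam' l w hw)
            (by exact_mod_cast hkl), ite_self, ite_self]
  · simp only [hgθ, hpiece, hgi, Submodule.map_iSup]
    refine iSup_le fun n => iSup_le fun k => iSup_le fun ⟨c, hc⟩ => ?_
    rintro _ ⟨_, ⟨v, hv, rfl⟩, rfl⟩
    refine Submodule.mem_iSup_of_mem (-c) ⟨v, Submodule.mem_top, ?_⟩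
    rw [TensorProduct.mk_apply, TensorProduct.mk_apply, hΦ n k v hv]
    congr 2
    linarith
  · simp only [← hsup, hgθ, hpiece, hgi, Submodule.map_iSup]
    refine iSup_le fun n => iSup_le fun k => ?_
    rintro _ ⟨v, hv, rfl⟩
    refine Submodule.mem_iSup_of_mem (m * n + k) <| Submodule.mem_iSup_of_mem k <|
      Submodule.mem_iSup_of_mem ⟨-n, by ring⟩ ⟨_, ⟨v, hv, rfl⟩, ?_⟩
    rw [TensorProduct.mk_apply, TensorProduct.mk_apply, hΦ _ k v hv, add_sub_cancel_right]
  · induction x using laurent_tensor_induction hsup with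
    | zero => simp [lie_zero']
    | add x y hx hy =>
      simp only [map_add, hx, hy, lie_add']
      abel
    | tmul i k v hv =>
      rw [hδ, map_smul, hΦ i k v hv, hδ, LieAlgebra.ExtendScalars.bracket_tmul, one_mul,
        hlam' k v hv, TensorProduct.tmul_smul, ← add_smul]
      congr 1
      push_cast
      ring
end

section
/- Let g be a finite-dimensional complex Lie algebra, d ≥ 0, and let Y_0, Y_1, …, Y_d ∈ g with ad Y_0 nilpotent. Suppose v : ℤ → g satisfies: (i) there exists b ∈ ℤ with v_n = 0 for all n < b; and (ii) for all n ∈ ℤ, n·v_n + Σ_{j=0}^{d} ⁅Y_j, v_{n-j}⁆ = 0. Then v_n = 0 for all n < 0, and ⁅Y_0, v_0⁆ = 0. -/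
/-- A nilpotent endomorphism has no eigenvector with nonzero eigenvalue. -/
theorem eq_zero_of_isNilpotent_of_smul_add_eq_zero {K M : Type*} [Field K] [AddCommGroup M]
    [Module K M] {N : Module.End K M} (hN : IsNilpotent N) {c : K} (hc : c ≠ 0) {x : M}
    (h : c • x + N x = 0) : x = 0 := by
  obtain ⟨k, hk⟩ := hN
  have hx : N x = (-c) • x := by
    rw [neg_smul]
    exact eq_neg_of_add_eq_zero_right h
  have hpow : ∀ m : ℕ, (N ^ m) x = (-c) ^ m • x := by
    intro m
    induction m with
    | zero => simp
    | succ m ih => rw [pow_succ, Module.End.mul_apply, hx, map_smul, ih, smul_smul, pow_succ']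
  have hzero := hpow k
  rw [hk, LinearMap.zero_apply] at hzero
  exact (smul_eq_zero.mp hzero.symm).resolve_left (pow_ne_zero k (neg_ne_zero.mpr hc))

/-- Let `g` be a finite-dimensional complex Lie algebra, `Y₀, …, Y_d ∈ g`
with `ad Y₀` nilpotent. Any `v : ℤ → g` vanishing for sufficiently negative indices
and satisfying `n·vₙ + Σ_{j=0}^{d} ⁅Yⱼ, v_{n-j}⁆ = 0` for all `n` has `vₙ = 0` for
all `n < 0` and `⁅Y₀, v₀⁆ = 0`. -/
theorem formal_solution_regular_singularity
    (g : Type*) [LieRing g] [LieAlgebra ℂ g] [Module.Finite ℂ g]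
    (d : ℕ) (Y : ℕ → g) (hY0 : IsNilpotent (LieAlgebra.ad ℂ g (Y 0)))
    (v : ℤ → g) (hsupp : ∃ b : ℤ, ∀ n : ℤ, n < b → v n = 0)
    (hrec : ∀ n : ℤ,
      (n : ℂ) • v n + ∑ j ∈ Finset.range (d + 1), ⁅Y j, v (n - (j : ℤ))⁆ = 0) :
    (∀ n : ℤ, n < 0 → v n = 0) ∧ ⁅Y 0, v 0⁆ = 0 := by
  obtain ⟨b, hb⟩ := hsupp
  have lead : ∀ n : ℤ, (∀ m < n, v m = 0) → (n : ℂ) • v n + ⁅Y 0, v n⁆ = 0 := by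
    intro n hn
    have h := hrec n
    rw [Finset.sum_range_succ', Finset.sum_eq_zero] at h
    · simpa using h
    · intro j _
      rw [hn _ (by push_cast; omega), lie_zero]
  have vanish : ∀ k : ℕ, ∀ n : ℤ, n < b + k → n < 0 → v n = 0 := by
    intro k
    induction k with
    | zero => exact fun n hn _ => hb n (by simpa using hn)
    | succ k ih =>
      intro n hn hneg
      refine eq_zero_of_isNilpotent_of_smul_add_eq_zero hY0
        (Int.cast_ne_zero.mpr hneg.ne : (n : ℂ) ≠ 0) ?_
      rw [LieAlgebra.ad_apply]
      refine lead n fun m hm => ih m ?_ (hm.trans hneg)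
      push_cast at hn
      omega
  have neg : ∀ n : ℤ, n < 0 → v n = 0 := fun n hn =>
    vanish (n - b + 1).toNat n (by omega) hn
  exact ⟨neg, by simpa using lead 0 neg⟩
end

section
/- Let g be a finite-dimensional complex Lie algebra, d ≥ 0, and let Y_0, Y_1, …, Y_d ∈ g with ad Y_0 nilpotent. Then for every w ∈ g with ⁅Y_0, w⁆ = 0 there exists a unique v : ℤ → g such that v_n = 0 for all n < 0, v_0 = w, and for all n ∈ ℤ, n·v_n + Σ_{j=0}^{d} ⁅Y_j, v_{n-j}⁆ = 0. Consequently, the map v ↦ v_0 is a ℂ-linear bijection from the space of solutions of this recursion that vanish for sufficiently negative n onto the centralizer {w ∈ g : ⁅Y_0, w⁆ = 0} of Y_0. -/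
section FormalRecursion

variable {K M : Type*} [Field K] [AddCommGroup M] [Module K M]

/-- The solution of `n • vₙ + ∑ j ≤ d, Aⱼ (vₙ₋ⱼ) = 0` with initial value `v₀ = w` that vanishes
at negative indices, for `A₀` nilpotent and `w` in its kernel. -/
noncomputable def recursionSolution (d : ℕ) (A : ℕ → Module.End K M) (w : M) (n : ℤ) : M :=
  if n < 0 then 0
  else if n = 0 then w
  else -Ring.inverse ((n : K) • (1 : Module.End K M) + A 0)
    (∑ j ∈ Finset.range d, A (j + 1) (recursionSolution d A w (n - ((j + 1 : ℕ) : ℤ))))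
termination_by n.toNat
decreasing_by lia

theorem recursionSolution_of_neg (d : ℕ) (A : ℕ → Module.End K M) (w : M) {n : ℤ} (hn : n < 0) :
    recursionSolution d A w n = 0 := by
  rw [recursionSolution, if_pos hn]

theorem recursionSolution_zero (d : ℕ) (A : ℕ → Module.End K M) (w : M) :
    recursionSolution d A w 0 = w := by
  rw [recursionSolution, if_neg (lt_irrefl _), if_pos rfl]

variable [CharZero K]

theorem isUnit_intCast_smul_one_add_of_isNilpotent {N : Module.End K M} (hN : IsNilpotent N)
    {n : ℤ} (hn : n ≠ 0) : IsUnit ((n : K) • (1 : Module.End K M) + N) := by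
  have hunit : IsUnit ((n : K) • (1 : Module.End K M)) := by
    rw [← Algebra.algebraMap_eq_smul_one]
    exact (IsUnit.mk0 _ (Int.cast_ne_zero.mpr hn)).map (algebraMap K (Module.End K M))
  exact hN.isUnit_add_left_of_commute hunit ((Commute.one_right N).smul_right (n : K))

/-- A solution `v` of `n • vₙ + ∑ j ≤ d, Aⱼ (vₙ₋ⱼ) = 0` vanishes at `n ≠ 0` if it vanishes at
all smaller indices. -/
theorem recursion_eq_zero_of_forall_lt {d : ℕ} {A : ℕ → Module.End K M}
    (hA : IsNilpotent (A 0)) {v : ℤ → M} {n : ℤ} (hn : n ≠ 0)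
    (hv : (n : K) • v n + ∑ j ∈ Finset.range (d + 1), A j (v (n - (j : ℤ))) = 0)
    (hlt : ∀ m < n, v m = 0) : v n = 0 := by
  have htail : ∑ j ∈ Finset.range d, A (j + 1) (v (n - ((j + 1 : ℕ) : ℤ))) = 0 :=
    Finset.sum_eq_zero fun j _ => by rw [hlt _ (by lia), map_zero]
  rw [Finset.sum_range_succ', htail, zero_add, Nat.cast_zero, sub_zero] at hv
  have hinj := ((Module.End.isUnit_iff _).mp
    (isUnit_intCast_smul_one_add_of_isNilpotent (K := K) hA hn)).injective
  exact hinj (by simpa using hv)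

/-- A property that holds far to the left and propagates to the right holds everywhere. -/
theorem Int.forall_of_forall_lt {p : ℤ → Prop} {b : ℤ} (hb : ∀ n < b, p n)
    (step : ∀ n, (∀ m < n, p m) → p n) (n : ℤ) : p n := by
  have key : ∀ k : ℕ, ∀ m < b + k, p m := by
    intro k
    induction k with
    | zero => simpa using hb
    | succ k ih => exact fun m hm => step m fun l hl => ih l (by lia)
  exact key (n - b + 1).toNat n (by lia)

theorem recursion_eq_zero_of_neg {d : ℕ} {A : ℕ → Module.End K M}
    (hA : IsNilpotent (A 0)) {v : ℤ → M} (hb : ∃ b : ℤ, ∀ n < b, v n = 0)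
    (hv : ∀ n : ℤ, (n : K) • v n + ∑ j ∈ Finset.range (d + 1), A j (v (n - (j : ℤ))) = 0)
    (n : ℤ) (hn : n < 0) : v n = 0 := by
  obtain ⟨b, hb⟩ := hb
  refine Int.forall_of_forall_lt (p := fun n => n < 0 → v n = 0) (fun n h _ => hb n h) ?_ n hn
  exact fun n ih hn => recursion_eq_zero_of_forall_lt hA hn.ne (hv n) fun m hm =>
    ih m hm (hm.trans hn)

theorem recursion_apply_zero_eq_zero {d : ℕ} {A : ℕ → Module.End K M}
    (hA : IsNilpotent (A 0)) {v : ℤ → M} (hb : ∃ b : ℤ, ∀ n < b, v n = 0)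
    (hv : ∀ n : ℤ, (n : K) • v n + ∑ j ∈ Finset.range (d + 1), A j (v (n - (j : ℤ))) = 0) :
    A 0 (v 0) = 0 := by
  have hneg := recursion_eq_zero_of_neg hA hb hv
  have h := hv 0
  rw [Finset.sum_range_succ', Finset.sum_eq_zero fun j _ => by rw [hneg _ (by lia), map_zero]] at h
  simpa using h

theorem recursion_eq_of_zero_eq {d : ℕ} {A : ℕ → Module.End K M}
    (hA : IsNilpotent (A 0)) {v v' : ℤ → M}
    (hb : ∃ b : ℤ, ∀ n < b, v n = 0) (hb' : ∃ b : ℤ, ∀ n < b, v' n = 0)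
    (hv : ∀ n : ℤ, (n : K) • v n + ∑ j ∈ Finset.range (d + 1), A j (v (n - (j : ℤ))) = 0)
    (hv' : ∀ n : ℤ, (n : K) • v' n + ∑ j ∈ Finset.range (d + 1), A j (v' (n - (j : ℤ))) = 0)
    (h0 : v 0 = v' 0) : v = v' := by
  obtain ⟨b, hb⟩ := hb
  obtain ⟨b', hb'⟩ := hb'
  have hsub (n : ℤ) : (n : K) • (v - v') n +
      ∑ j ∈ Finset.range (d + 1), A j ((v - v') (n - (j : ℤ))) = 0 := by
    have h := congrArg₂ (· - ·) (hv n) (hv' n)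
    simp only [sub_zero, add_sub_add_comm, ← smul_sub, ← Finset.sum_sub_distrib, ← map_sub] at h
    exact h
  rw [← sub_eq_zero]
  funext n
  refine Int.forall_of_forall_lt (p := fun n => (v - v') n = 0) (b := min b b') ?_ ?_ n
  · intro n hn
    rw [Pi.sub_apply, hb n (by lia), hb' n (by lia), sub_zero]
  · intro n ih
    obtain rfl | hn := eq_or_ne n 0
    · simpa [sub_eq_zero] using h0
    · exact recursion_eq_zero_of_forall_lt hA hn (hsub n) ih

theorem recursionSolution_spec (d : ℕ) {A : ℕ → Module.End K M} (hA : IsNilpotent (A 0)) {w : M}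
    (hw : A 0 w = 0) (n : ℤ) :
    (n : K) • recursionSolution d A w n +
      ∑ j ∈ Finset.range (d + 1), A j (recursionSolution d A w (n - (j : ℤ))) = 0 := by
  rw [Finset.sum_range_succ', Nat.cast_zero, sub_zero]
  rcases lt_trichotomy n 0 with hn | rfl | hn
  · rw [recursionSolution_of_neg d A w hn, Finset.sum_eq_zero fun j _ => by
      rw [recursionSolution_of_neg d A w (by lia), map_zero]]
    simp
  · rw [recursionSolution_zero, Finset.sum_eq_zero fun j _ => by
      rw [recursionSolution_of_neg d A w (by lia), map_zero]]
    simp [hw]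
  · set s := ∑ j ∈ Finset.range d,
      A (j + 1) (recursionSolution d A w (n - ((j + 1 : ℕ) : ℤ)))
    have hval : recursionSolution d A w n =
        -Ring.inverse ((n : K) • (1 : Module.End K M) + A 0) s := by
      rw [recursionSolution, if_neg hn.not_gt, if_neg hn.ne']
    have hinv := congrArg (fun f : Module.End K M => f s) (Ring.mul_inverse_cancel _
      (isUnit_intCast_smul_one_add_of_isNilpotent (K := K) hA hn.ne'))
    have hT : (n : K) • recursionSolution d A w n + A 0 (recursionSolution d A w n) = -s := by
      rw [hval, map_neg, smul_neg, ← neg_add]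
      exact congrArg Neg.neg hinv
    rw [add_left_comm, hT, add_neg_cancel]

end FormalRecursion


/-- Let `g` be a finite-dimensional complex Lie algebra,
`Y₀, …, Y_d ∈ g` with `ad Y₀` nilpotent. For every `w` in the centralizer of `Y₀`
there is a unique `v : ℤ → g` with `vₙ = 0` for `n < 0`, `v₀ = w`, and
`n·vₙ + Σ_{j=0}^{d} ⁅Yⱼ, v_{n-j}⁆ = 0` for all `n`; consequently `v ↦ v₀` is a
bijection from the space of solutions of the recursion vanishing for sufficiently
negative `n` onto the centralizer of `Y₀`. -/
theorem formal_solution_bijection_centralizer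
    (g : Type*) [LieRing g] [LieAlgebra ℂ g] [Module.Finite ℂ g]
    (d : ℕ) (Y : ℕ → g) (hY0 : IsNilpotent (LieAlgebra.ad ℂ g (Y 0))) :
    (∀ w : g, ⁅Y 0, w⁆ = 0 →
      ∃! v : ℤ → g, (∀ n : ℤ, n < 0 → v n = 0) ∧ v 0 = w ∧
        (∀ n : ℤ,
          (n : ℂ) • v n + ∑ j ∈ Finset.range (d + 1), ⁅Y j, v (n - (j : ℤ))⁆ = 0)) ∧
    (∀ v v' : ℤ → g,
      (∃ b : ℤ, ∀ n : ℤ, n < b → v n = 0) → (∃ b : ℤ, ∀ n : ℤ, n < b → v' n = 0) →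
      (∀ n : ℤ,
        (n : ℂ) • v n + ∑ j ∈ Finset.range (d + 1), ⁅Y j, v (n - (j : ℤ))⁆ = 0) →
      (∀ n : ℤ,
        (n : ℂ) • v' n + ∑ j ∈ Finset.range (d + 1), ⁅Y j, v' (n - (j : ℤ))⁆ = 0) →
      v 0 = v' 0 → v = v') ∧
    (∀ v : ℤ → g, (∃ b : ℤ, ∀ n : ℤ, n < b → v n = 0) →
      (∀ n : ℤ,
        (n : ℂ) • v n + ∑ j ∈ Finset.range (d + 1), ⁅Y j, v (n - (j : ℤ))⁆ = 0) →
      ⁅Y 0, v 0⁆ = 0) := by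
  let A : ℕ → Module.End ℂ g := fun j => LieAlgebra.ad ℂ g (Y j)
  have hA : IsNilpotent (A 0) := hY0
  refine ⟨fun w hw => ?_, fun v v' hb hb' hv hv' h0 =>
    recursion_eq_of_zero_eq (A := A) hA hb hb' hv hv' h0,
    fun v hb hv => recursion_apply_zero_eq_zero (A := A) hA hb hv⟩
  have hneg : ∀ n : ℤ, n < 0 → recursionSolution d A w n = 0 :=
    fun n hn => recursionSolution_of_neg d A w hn
  have hzero := recursionSolution_zero d A w
  have hspec := recursionSolution_spec d hA hw
  exact ⟨recursionSolution d A w, ⟨hneg, hzero, hspec⟩, fun v ⟨hvneg, hv0, hv⟩ =>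
    recursion_eq_of_zero_eq hA ⟨0, hvneg⟩ ⟨0, hneg⟩ hv hspec (hv0.trans hzero.symm)⟩
end

section
/- Let g be a finite-dimensional semisimple Lie algebra over ℂ with a ℤ-grading g = ⊕_{k∈ℤ} g(k) such that g(k) = 0 for |k| ≥ m, where m is a positive integer; set ξ_m = exp(2πi/m), let θ be the automorphism of g acting on g(k) by ξ_m^k, and g_i = ⊕_{k ≡ i (mod m)} g(k). Let X₁ ∈ g(1), X' ∈ g(1−m), and suppose X := X₁ + X' ∈ g_1 is stable, i.e. X is regular semisimple (ad X semisimple with ker(ad X) a Cartan subalgebra) and ker(ad X) ∩ g_0 = 0. Then every v : ℤ → g (with no support condition) satisfying, for all n ∈ ℤ, n·v_n + ⁅X₁, v_n⁆ + ⁅X', v_{n−1}⁆ = 0, has v_n = 0 for all n < 0. -/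
section GradedProjection

variable {R M ι : Type*} [CommRing R] [AddCommGroup M] [Module R M] [DecidableEq ι]
  {V : ι → Submodule R M}

/-- The projection of a graded module onto its homogeneous component of index `k`. -/
noncomputable def gradedProjection (hV : DirectSum.IsInternal V) (k : ι) : M →ₗ[R] M :=
  letI := hV.chooseDecomposition
  (V k).subtype ∘ₗ DirectSum.component R ι (fun i ↦ V i) k ∘ₗ
    (DirectSum.decomposeLinearEquiv V).toLinearMap

variable (hV : DirectSum.IsInternal V)

lemma gradedProjection_mem (k : ι) (x : M) : gradedProjection hV k x ∈ V k :=
  Subtype.property _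

lemma gradedProjection_of_mem {k : ι} {x : M} (hx : x ∈ V k) :
    gradedProjection hV k x = x :=
  letI := hV.chooseDecomposition
  DirectSum.decompose_of_mem_same V hx

lemma gradedProjection_of_mem_ne {k l : ι} {x : M} (hx : x ∈ V k) (h : k ≠ l) :
    gradedProjection hV l x = 0 :=
  letI := hV.chooseDecomposition
  DirectSum.decompose_of_mem_ne V hx h

lemma eq_zero_of_gradedProjection_eq_zero {x : M} (h : ∀ k, gradedProjection hV k x = 0) :
    x = 0 := by
  let := hV.chooseDecomposition
  apply (DirectSum.decomposeLinearEquiv V).injective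
  rw [map_zero]
  exact DFinsupp.ext fun k ↦ Subtype.ext (h k)

end GradedProjection

/-- A linear map may be prescribed to act by a scalar on each homogeneous component. -/
lemma exists_linearMap_smul_of_mem {R M ι : Type*} [CommRing R] [AddCommGroup M] [Module R M]
    [DecidableEq ι] {V : ι → Submodule R M} (hV : DirectSum.IsInternal V) (c : ι → R) :
    ∃ D : M →ₗ[R] M, ∀ k, ∀ x ∈ V k, D x = c k • x := by
  let := hV.chooseDecomposition
  refine ⟨DirectSum.toModule R ι M (fun k ↦ c k • (V k).subtype) ∘ₗ
    (DirectSum.decomposeLinearEquiv V).toLinearMap, fun k x hx ↦ ?_⟩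
  lift x to V k using hx
  simp

lemma gradedProjection_lie {R L : Type*} [CommRing R] [LieRing L] [LieAlgebra R L]
    {V : ℤ → Submodule R L} (hV : DirectSum.IsInternal V)
    (hbr : ∀ k l : ℤ, ∀ x ∈ V k, ∀ y ∈ V l, ⁅x, y⁆ ∈ V (k + l))
    {k : ℤ} {x : L} (hx : x ∈ V k) (l : ℤ) (y : L) :
    gradedProjection hV (k + l) ⁅x, y⁆ = ⁅x, gradedProjection hV l y⁆ := by
  let := hV.chooseDecomposition
  induction y using DirectSum.Decomposition.inductionOn V with
  | zero => simp
  | add a b ha hb => simp [ha, hb]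
  | @homogeneous i a =>
    rcases eq_or_ne i l with rfl | hne
    · rw [gradedProjection_of_mem hV (hbr _ _ _ hx _ a.2), gradedProjection_of_mem hV a.2]
    · rw [gradedProjection_of_mem_ne hV (hbr _ _ _ hx _ a.2) (by omega),
        gradedProjection_of_mem_ne hV a.2 hne, lie_zero]

/-- The derivation of a `ℤ`-graded Lie algebra multiplying each homogeneous element by its
degree. -/
lemma exists_lieDerivation_degree {R L : Type*} [CommRing R] [LieRing L] [LieAlgebra R L]
    {V : ℤ → Submodule R L} (hV : DirectSum.IsInternal V)
    (hbr : ∀ k l : ℤ, ∀ x ∈ V k, ∀ y ∈ V l, ⁅x, y⁆ ∈ V (k + l)) :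
    ∃ D : LieDerivation R L L, ∀ k, ∀ x ∈ V k, D x = (k : R) • x := by
  obtain ⟨D, hD⟩ := exists_linearMap_smul_of_mem hV (fun k : ℤ ↦ (k : R))
  refine ⟨⟨D, fun a b ↦ ?_⟩, hD⟩
  let := hV.chooseDecomposition
  induction a using DirectSum.Decomposition.inductionOn V with
  | zero => simp
  | add a a' ha ha' =>
    simp only [add_lie, map_add, lie_add, ha, ha']
    abel
  | @homogeneous i a =>
    induction b using DirectSum.Decomposition.inductionOn V with
    | zero => simp
    | add b b' hb hb' =>
      simp only [add_lie, map_add, lie_add, hb, hb']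
      abel
    | @homogeneous j b =>
      rw [hD _ _ (hbr _ _ _ a.2 _ b.2), hD _ _ a.2, hD _ _ b.2, lie_smul, lie_smul,
        ← lie_skew (a : L) (b : L)]
      push_cast
      module

/-- If the centralizer of `X` is a Cartan subalgebra, then a derivation has no nonzero
eigenvector in it, even modulo the image of `ad X`, with nonzero eigenvalue. -/
lemma eq_zero_of_smul_sub_derivation_eq_lie {K L : Type*} [Field K] [CharZero K] [LieRing L]
    [LieAlgebra K L] [Module.Finite K L] [LieAlgebra.IsKilling K L] {X : L}
    (hX : (centralizerSubalgebra K L X).IsCartanSubalgebra) (D : LieDerivation K L L)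
    {c : K} (hc : c ≠ 0) {w y : L} (hw : ⁅X, w⁆ = 0) (h : c • w - D w = ⁅X, y⁆) : w = 0 := by
  set H := centralizerSubalgebra K L X
  obtain ⟨r, rfl⟩ := LieDerivation.IsKilling.exists_eq_ad D
  have hcomm : ∀ z ∈ H, ⁅w, z⁆ = 0 := fun z hz ↦ by
    have := trivial_lie_zero H H ⟨w, hw⟩ ⟨z, hz⟩
    exact congrArg Subtype.val this
  have hker := LieAlgebra.IsKilling.ker_restrict_eq_bot_of_isCartanSubalgebra K L H
  have hmem : (⟨w, hw⟩ : H) ∈ LinearMap.ker ((killingForm K L).restrict H) := by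
    rw [LinearMap.mem_ker]
    ext ⟨z, hz⟩
    change killingForm K L w z = 0
    have hXz : ⁅X, z⁆ = 0 := hz
    have h₁ : killingForm K L (c • w - ⁅r, w⁆) z = 0 := by
      have had : LieDerivation.ad K L r w = ⁅r, w⁆ := by simp
      rw [← had, h, ← lie_skew, map_neg, LinearMap.neg_apply,
        LieModule.traceForm_apply_lie_apply, hXz, map_zero, neg_zero]
    rw [map_sub, map_smul, LinearMap.sub_apply, LinearMap.smul_apply,
      LieModule.traceForm_apply_lie_apply, hcomm z hz, map_zero, sub_zero, smul_eq_mul] at h₁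
    exact (mul_eq_zero.mp h₁).resolve_left hc
  rw [hker, Submodule.mem_bot] at hmem
  exact congrArg Subtype.val hmem

/-- The part of total degree `d` of the formal series `∑ vₙ tⁿ`, where `t` has
degree `m`. -/
noncomputable def totalDegreePart {R M : Type*} [CommRing R] [AddCommGroup M] [Module R M]
    {V : ℤ → Submodule R M} (hV : DirectSum.IsInternal V) (m : ℕ) (v : ℤ → M) (d : ℤ) : M :=
  ∑ᶠ n : ℤ, gradedProjection hV (d - m * n) (v n)

section

variable {R M : Type*} [CommRing R] [AddCommGroup M] [Module R M]
  {V : ℤ → Submodule R M} (hV : DirectSum.IsInternal V) {m : ℕ}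

lemma hasFiniteSupport_gradedProjection_sub_mul (hm : 0 < m)
    (hbound : ∀ k : ℤ, (m : ℤ) ≤ |k| → V k = ⊥) (v : ℤ → M) (d : ℤ) :
    Function.HasFiniteSupport fun n : ℤ ↦ gradedProjection hV (d - m * n) (v n) := by
  refine (Set.finite_Icc (-(|d| + m)) (|d| + m)).subset fun n hn ↦ ?_
  have hlt : |d - m * n| < m := by
    by_contra! hle
    have := gradedProjection_mem hV (d - m * n) (v n)
    rw [hbound _ hle, Submodule.mem_bot] at this
    exact hn this
  have h₁ : |n| ≤ |m * n| := by
    rw [abs_mul, Nat.abs_cast]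
    exact le_mul_of_one_le_left (abs_nonneg n) (by exact_mod_cast hm)
  have h₂ : |m * n| ≤ |d| + |d - m * n| := by
    simpa using abs_sub d (d - m * n)
  exact abs_le.mp (by linarith)

lemma gradedProjection_eq_zero_of_totalDegreePart_eq_zero (hm : 0 < m)
    (hbound : ∀ k : ℤ, (m : ℤ) ≤ |k| → V k = ⊥) {v : ℤ → M} {d : ℤ}
    (h : totalDegreePart hV m v d = 0) (n : ℤ) :
    gradedProjection hV (d - m * n) (v n) = 0 := by
  have h' := congrArg (gradedProjection hV (d - m * n)) h
  rw [totalDegreePart,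
    map_finsum _ (hasFiniteSupport_gradedProjection_sub_mul hV hm hbound v d), map_zero,
    finsum_eq_single _ n fun i hi ↦ gradedProjection_of_mem_ne hV (gradedProjection_mem hV _ _)
      fun he ↦ hi <| mul_left_cancel₀ (Nat.cast_ne_zero.mpr hm.ne' : (m : ℤ) ≠ 0) (by linarith),
    gradedProjection_of_mem hV (gradedProjection_mem hV _ _)] at h'
  exact h'

end

/-- The recursion satisfied by the coefficients `vₙ`, in terms of total degree. -/
lemma smul_totalDegreePart_sub_derivation {R L : Type*} [CommRing R] [LieRing L]
    [LieAlgebra R L] {V : ℤ → Submodule R L} (hV : DirectSum.IsInternal V)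
    (hbr : ∀ k l : ℤ, ∀ x ∈ V k, ∀ y ∈ V l, ⁅x, y⁆ ∈ V (k + l))
    {m : ℕ} (hm : 0 < m) (hbound : ∀ k : ℤ, (m : ℤ) ≤ |k| → V k = ⊥)
    {X₁ X' : L} (hX₁ : X₁ ∈ V 1) (hX' : X' ∈ V (1 - m)) {v : ℤ → L}
    (hrec : ∀ n : ℤ, (n : R) • v n + ⁅X₁, v n⁆ + ⁅X', v (n - 1)⁆ = 0)
    {D : LieDerivation R L L} (hD : ∀ k, ∀ x ∈ V k, D x = (k : R) • x) (d : ℤ) :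
    (d : R) • totalDegreePart hV m v d - D (totalDegreePart hV m v d) =
      ⁅X₁ + X', -((m : R) • totalDegreePart hV m v (d - 1))⁆ := by
  have hfin := hasFiniteSupport_gradedProjection_sub_mul hV hm hbound
  have h₁ : ⁅X₁, totalDegreePart hV m v (d - 1)⁆ =
      totalDegreePart hV m (fun n ↦ ⁅X₁, v n⁆) d := by
    rw [totalDegreePart, totalDegreePart, ← LieAlgebra.ad_apply R, map_finsum _ (hfin v _)]
    refine finsum_congr fun n ↦ ?_
    rw [LieAlgebra.ad_apply, ← gradedProjection_lie hV hbr hX₁]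
    ring_nf
  have h₂ : ⁅X', totalDegreePart hV m v (d - 1)⁆ =
      totalDegreePart hV m (fun n ↦ ⁅X', v (n - 1)⁆) d := by
    rw [totalDegreePart, totalDegreePart, ← LieAlgebra.ad_apply R, map_finsum _ (hfin v _),
      ← finsum_comp_equiv (Equiv.subRight (1 : ℤ))]
    refine finsum_congr fun n ↦ ?_
    rw [LieAlgebra.ad_apply, ← gradedProjection_lie hV hbr hX', Equiv.subRight_apply]
    ring_nf
  have h₃ : (d : R) • totalDegreePart hV m v d - D (totalDegreePart hV m v d) =
      (m : R) • totalDegreePart hV m (fun n ↦ (n : R) • v n) d := by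
    have hsum (f : L →ₗ[R] L) (u : ℤ → L) : f (totalDegreePart hV m u d) =
        ∑ᶠ n : ℤ, f (gradedProjection hV (d - m * n) (u n)) := map_finsum f (hfin u d)
    have hl := hsum ((d : R) • LinearMap.id - D.toLinearMap) v
    have hr := hsum ((m : R) • LinearMap.id) fun n ↦ (n : R) • v n
    refine (hl.trans (finsum_congr fun n ↦ ?_)).trans hr.symm
    change (d : R) • gradedProjection hV (d - m * n) (v n) -
      D (gradedProjection hV (d - m * n) (v n)) =
        (m : R) • gradedProjection hV (d - m * n) ((n : R) • v n)
    rw [hD _ _ (gradedProjection_mem hV _ _), map_smul (gradedProjection hV _)]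
    push_cast
    module
  have h₄ : totalDegreePart hV m (fun n ↦ (n : R) • v n) d +
      totalDegreePart hV m (fun n ↦ ⁅X₁, v n⁆) d +
      totalDegreePart hV m (fun n ↦ ⁅X', v (n - 1)⁆) d = 0 := by
    simp only [totalDegreePart]
    rw [← finsum_add_distrib (hfin _ d) (hfin _ d), ← finsum_add_distrib
      (by simpa only [map_add] using hfin (fun n ↦ (n : R) • v n + ⁅X₁, v n⁆) d) (hfin _ d)]
    simp only [← map_add, hrec, map_zero, finsum_zero]
  rw [h₃, lie_neg, lie_smul, add_lie, h₁, h₂, ← smul_neg]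
  congr 1
  rw [eq_neg_iff_add_eq_zero, ← add_assoc, h₄]

/-- Let `g = ⊕ₖ g(k)` be a ℤ-graded finite-dimensional complex
semisimple Lie algebra with `g(k) = 0` for `|k| ≥ m`, and let `X = X₁ + X'`
(`X₁ ∈ g(1)`, `X' ∈ g(1-m)`) be stable: regular semisimple with
`ker(ad X) ∩ g₀ = 0`, where `g₀ = ⊕_{m ∣ k} g(k)`. Then every `v : ℤ → g`
satisfying `n·vₙ + ⁅X₁, vₙ⁆ + ⁅X', v_{n-1}⁆ = 0` for all `n` has `vₙ = 0` for all
`n < 0`. -/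
theorem formal_solution_stable_no_negative_coefficients
    (g : Type*) [LieRing g] [LieAlgebra ℂ g] [Module.Finite ℂ g]
    [LieAlgebra.IsSemisimple ℂ g]
    (m : ℕ) (hm : 0 < m)
    (V : ℤ → Submodule ℂ g) (hV : DirectSum.IsInternal V)
    (hbr : ∀ k l : ℤ, ∀ x ∈ V k, ∀ y ∈ V l, ⁅x, y⁆ ∈ V (k + l))
    (hbound : ∀ k : ℤ, (m : ℤ) ≤ |k| → V k = ⊥)
    (X₁ X' : g) (hX₁ : X₁ ∈ V 1) (hX' : X' ∈ V (1 - m))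
    (X : g) (hX : X = X₁ + X')
    (hss : (LieAlgebra.ad ℂ g X).IsSemisimple)
    (hCartan : (centralizerSubalgebra ℂ g X).IsCartanSubalgebra)
    (g0 : Submodule ℂ g) (hg0 : g0 = ⨆ k : ℤ, ⨆ _ : (m : ℤ) ∣ k, V k)
    (hstable : LinearMap.ker (LieAlgebra.ad ℂ g X) ⊓ g0 = ⊥)
    (v : ℤ → g)
    (hrec : ∀ n : ℤ, (n : ℂ) • v n + ⁅X₁, v n⁆ + ⁅X', v (n - 1)⁆ = 0) :
    ∀ n : ℤ, n < 0 → v n = 0 := by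
  subst hX
  obtain ⟨D, hD⟩ := exists_lieDerivation_degree hV hbr
  have hrel := smul_totalDegreePart_sub_derivation hV hbr hm hbound hX₁ hX' hrec hD
  have hm' : (m : ℂ) ≠ 0 := Nat.cast_ne_zero.mpr hm.ne'
  have hD₀ : D (totalDegreePart hV m v 0) = 0 := by
    rw [totalDegreePart, finsum_eq_single _ 0 fun n hn ↦ ?_, hD _ _ (gradedProjection_mem hV _ _)]
    · simp
    · have hle : (m : ℤ) ≤ |0 - m * n| := by
        rw [zero_sub, abs_neg, abs_mul, Nat.abs_cast]
        exact le_mul_of_one_le_right (by positivity) (Int.one_le_abs hn)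
      have hmem := gradedProjection_mem hV (0 - m * n) (v n)
      rwa [hbound _ hle, Submodule.mem_bot] at hmem
  have hstep (d : ℤ) (hd : d ≤ 0) (h : (d : ℂ) • totalDegreePart hV m v d -
      D (totalDegreePart hV m v d) = 0) : totalDegreePart hV m v (d - 1) = 0 := by
    have hlie : ⁅X₁ + X', totalDegreePart hV m v (d - 1)⁆ = 0 := by
      rw [hrel, lie_neg, neg_eq_zero, lie_smul] at h
      exact (smul_eq_zero.mp h).resolve_left hm'
    exact eq_zero_of_smul_sub_derivation_eq_lie hCartan D
      (Int.cast_ne_zero.mpr (by omega : d - 1 ≠ 0)) hlie (hrel (d - 1))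
  have hzero (d : ℤ) (hd : d ≤ -1) : totalDegreePart hV m v d = 0 := by
    induction d, hd using Int.leInductionDown with
    | base => exact hstep 0 le_rfl (by simp [hD₀])
    | pred d hd ih => exact hstep d (by omega) (by simp [ih])
  intro n hn
  refine eq_zero_of_gradedProjection_eq_zero hV fun k ↦ ?_
  by_cases hk : (m : ℤ) ≤ |k|
  · have hmem := gradedProjection_mem hV k (v n)
    rwa [hbound k hk, Submodule.mem_bot] at hmem
  · have hkm : k < m := (le_abs_self k).trans_lt (not_le.mp hk)
    have hmn : (m : ℤ) * n ≤ -m := by nlinarith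
    simpa using gradedProjection_eq_zero_of_totalDegreePart_eq_zero hV hm hbound
      (hzero (k + m * n) (by omega)) n
end

section
/- Let g be a finite-dimensional semisimple Lie algebra over ℂ with a ℤ-grading g = ⊕_{k∈ℤ} g(k) such that g(k) = 0 for |k| ≥ m, where m is a positive integer; set ξ_m = exp(2πi/m), let θ be the automorphism of g acting on g(k) by ξ_m^k, and g_i = ⊕_{k ≡ i (mod m)} g(k). Let X₁ ∈ g(1), X' ∈ g(1−m), and suppose X := X₁ + X' ∈ g_1 is stable, i.e. regular semisimple with ker(ad X) ∩ g_0 = 0. Then the map v ↦ v_0 is a ℂ-linear bijection from the space of all v : ℤ → g satisfying n·v_n + ⁅X₁, v_n⁆ + ⁅X', v_{n−1}⁆ = 0 for every n ∈ ℤ onto the centralizer {w ∈ g : ⁅X₁, w⁆ = 0} of X₁ in g. -/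
section Grading

variable {g : Type*} [LieRing g] [LieAlgebra ℂ g] {V : ℤ → Submodule ℂ g}

/-- The projection of `g` onto the component of degree `k` of an internal grading. -/
noncomputable def gradedProj (hV : DirectSum.IsInternal V) (k : ℤ) : g →ₗ[ℂ] g :=
  (V k).subtype ∘ₗ DirectSum.component ℂ ℤ (fun i => V i) k ∘ₗ
    (LinearEquiv.ofBijective (DirectSum.coeLinearMap V) hV).symm.toLinearMap

theorem gradedProj_mem (hV : DirectSum.IsInternal V) (k : ℤ) (x : g) :
    gradedProj hV k x ∈ V k := by
  simp [gradedProj]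

theorem ofBijective_coeLinearMap_symm_apply (hV : DirectSum.IsInternal V) {k : ℤ} {x : g}
    (hx : x ∈ V k) :
    (LinearEquiv.ofBijective (DirectSum.coeLinearMap V) hV).symm x =
      DirectSum.lof ℂ ℤ (fun i => V i) k ⟨x, hx⟩ := by
  rw [LinearEquiv.symm_apply_eq]
  exact (DirectSum.coeLinearMap_lof V k ⟨x, hx⟩).symm

theorem gradedProj_of_mem (hV : DirectSum.IsInternal V) {k : ℤ} {x : g} (hx : x ∈ V k) :
    gradedProj hV k x = x := by
  simp [gradedProj, ofBijective_coeLinearMap_symm_apply hV hx, DirectSum.component.lof_self]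

theorem gradedProj_of_mem_ne (hV : DirectSum.IsInternal V) {k l : ℤ} {x : g} (hx : x ∈ V k)
    (hkl : k ≠ l) : gradedProj hV l x = 0 := by
  simp [gradedProj, ofBijective_coeLinearMap_symm_apply hV hx, DirectSum.component.of, hkl]

theorem gradedProj_eq_zero (hV : DirectSum.IsInternal V) {k : ℤ} (hk : V k = ⊥) (x : g) :
    gradedProj hV k x = 0 := by
  simpa [hk] using gradedProj_mem hV k x

theorem eq_zero_of_gradedProj_eq_zero (hV : DirectSum.IsInternal V) {x : g}
    (hx : ∀ k, gradedProj hV k x = 0) : x = 0 := by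
  rw [← (LinearEquiv.ofBijective (DirectSum.coeLinearMap V) hV).symm.map_eq_zero_iff]
  refine DirectSum.ext_component ℂ fun k => Subtype.ext ?_
  simpa [gradedProj] using hx k

theorem isInternal_induction (hV : DirectSum.IsInternal V) {p : g → Prop}
    (hmem : ∀ k, ∀ x ∈ V k, p x) (hadd : ∀ x y, p x → p y → p (x + y)) (x : g) : p x := by
  have hx : x ∈ ⨆ k, V k := by
    rw [hV.submodule_iSup_eq_top]
    trivial
  exact Submodule.iSup_induction V (motive := p) hx hmem (hmem 0 0 (zero_mem _)) hadd

/-- Bracketing with a homogeneous element shifts the homogeneous components. -/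
theorem gradedProj_lie (hV : DirectSum.IsInternal V)
    (hbr : ∀ k l : ℤ, ∀ x ∈ V k, ∀ y ∈ V l, ⁅x, y⁆ ∈ V (k + l))
    {i k l : ℤ} {y : g} (hy : y ∈ V i) (hl : i + k = l) (x : g) :
    gradedProj hV l ⁅y, x⁆ = ⁅y, gradedProj hV k x⁆ := by
  subst hl
  induction x using isInternal_induction hV with
  | hmem j x hx =>
    have hyx := hbr i j y hy x hx
    by_cases h : j = k
    · subst h
      rw [gradedProj_of_mem hV hyx, gradedProj_of_mem hV hx]
    · rw [gradedProj_of_mem_ne hV hyx (by omega), gradedProj_of_mem_ne hV hx h, lie_zero]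
  | hadd x y hx hy => rw [lie_add, map_add, map_add, lie_add, hx, hy]

/-- A grading of a Lie algebra with nondegenerate Killing form is induced by an inner
derivation. -/
theorem exists_lie_eq_smul_of_isInternal [Module.Finite ℂ g] [LieAlgebra.IsKilling ℂ g]
    (hV : DirectSum.IsInternal V)
    (hbr : ∀ k l : ℤ, ∀ x ∈ V k, ∀ y ∈ V l, ⁅x, y⁆ ∈ V (k + l)) :
    ∃ r : g, ∀ k, ∀ x ∈ V k, ⁅r, x⁆ = (k : ℂ) • x := by
  let e := LinearEquiv.ofBijective (DirectSum.coeLinearMap V) hV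
  let H : g →ₗ[ℂ] g :=
    DirectSum.toModule ℂ ℤ g (fun k => (k : ℂ) • (V k).subtype) ∘ₗ e.symm.toLinearMap
  have hH : ∀ k, ∀ x ∈ V k, H x = (k : ℂ) • x := by
    intro k x hx
    simp only [H, e, LinearMap.comp_apply, LinearEquiv.coe_coe,
      ofBijective_coeLinearMap_symm_apply hV hx, DirectSum.toModule_lof]
    simp
  have hleib : ∀ a b, H ⁅a, b⁆ = ⁅a, H b⁆ - ⁅b, H a⁆ := by
    intro a b
    induction a using isInternal_induction hV with
    | hmem i a ha =>
      induction b using isInternal_induction hV with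
      | hmem j b hb =>
        rw [hH _ _ (hbr i j a ha b hb), hH _ _ ha, hH _ _ hb, lie_smul, lie_smul,
          ← lie_skew a b, smul_neg]
        push_cast
        module
      | hadd b c hb hc =>
        rw [lie_add, map_add, map_add, lie_add, add_lie, hb, hc]
        abel
    | hadd a c ha hc =>
      rw [add_lie, map_add, map_add, lie_add, add_lie, ha, hc]
      abel
  obtain ⟨r, hr⟩ := LieDerivation.IsKilling.exists_eq_ad (R := ℂ) (L := g) ⟨H, hleib⟩
  refine ⟨r, fun k x hx => ?_⟩
  rw [← hH k x hx]
  have h := congrArg (fun D => D.toLinearMap x) hr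
  dsimp only at h
  rw [← h]
  exact (LinearMap.congr_fun (LieDerivation.coe_ad_apply_eq_ad_apply r) x).symm

/-- If `c ≠ 0`, no nonzero `a` in the Cartan subalgebra centralizing `X` has
`c • a - ⁅r, a⁆` in the image of `ad X`. -/
theorem eq_zero_of_smul_sub_lie_eq_lie [Module.Finite ℂ g] [LieAlgebra.IsKilling ℂ g]
    {X : g} (hCartan : (centralizerSubalgebra ℂ g X).IsCartanSubalgebra)
    {c : ℂ} (hc : c ≠ 0) {r a z : g} (ha : ⁅X, a⁆ = 0) (h : c • a - ⁅r, a⁆ = ⁅X, z⁆) :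
    a = 0 := by
  have key : ∀ y, ⁅X, y⁆ = 0 → killingForm ℂ g a y = 0 := by
    intro y hy
    have hay : ⁅a, y⁆ = 0 := congrArg Subtype.val
      (trivial_lie_zero (centralizerSubalgebra ℂ g X) (centralizerSubalgebra ℂ g X)
        ⟨a, ha⟩ ⟨y, hy⟩)
    have h₁ : killingForm ℂ g ⁅r, a⁆ y = 0 := by
      rw [LieModule.traceForm_apply_lie_apply, hay, map_zero]
    have h₂ : killingForm ℂ g ⁅X, z⁆ y = 0 := by
      rw [LieModule.traceForm_apply_lie_apply', hy, map_zero, neg_zero]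
    have h₃ := congrArg (fun x => killingForm ℂ g x y) h
    simpa [h₁, h₂, hc] using h₃
  have hmem : (⟨a, ha⟩ : centralizerSubalgebra ℂ g X) ∈
      LinearMap.ker ((killingForm ℂ g).restrict (centralizerSubalgebra ℂ g X).toSubmodule) := by
    refine LinearMap.mem_ker.mpr (LinearMap.ext fun y => key y y.2)
  rw [LieAlgebra.IsKilling.ker_restrict_eq_bot_of_isCartanSubalgebra] at hmem
  exact congrArg Subtype.val ((Submodule.mem_bot ℂ).mp hmem)

/-- If `ad X₁` raises degrees by one, its kernel is at least as large as the degree zero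
component. -/
theorem finrank_le_finrank_ker_ad [Module.Finite ℂ g] (hV : DirectSum.IsInternal V)
    (hbr : ∀ k l : ℤ, ∀ x ∈ V k, ∀ y ∈ V l, ⁅x, y⁆ ∈ V (k + l)) {X₁ : g} (hX₁ : X₁ ∈ V 1) :
    Module.finrank ℂ (V 0) ≤
      Module.finrank ℂ (LinearMap.ker (LieAlgebra.ad ℂ g X₁)) := by
  let A : Submodule ℂ g := ⨅ k : ℤ, ⨅ _ : k < 0, LinearMap.ker (gradedProj hV k)
  have hA : ∀ x, x ∈ A ↔ ∀ k < 0, gradedProj hV k x = 0 := by simp [A]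
  let N : A →ₗ[ℂ] A := (LieAlgebra.ad ℂ g X₁).restrict (p := A) (q := A) fun x hx => by
    rw [hA] at hx ⊢
    intro k hk
    rw [LieAlgebra.ad_apply, gradedProj_lie hV hbr hX₁ (k := k - 1) (by ring),
      hx _ (by omega), lie_zero]
  let P : A →ₗ[ℂ] V 0 := (gradedProj hV 0).restrict fun x _ => gradedProj_mem hV 0 x
  have hP : Function.Surjective P := by
    rintro ⟨y, hy⟩
    refine ⟨⟨y, (hA y).mpr fun k hk => gradedProj_of_mem_ne hV hy hk.ne'⟩, Subtype.ext ?_⟩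
    exact gradedProj_of_mem hV hy
  have hNP : LinearMap.range N ≤ LinearMap.ker P := by
    rintro _ ⟨x, rfl⟩
    refine LinearMap.mem_ker.mpr (Subtype.ext ?_)
    change gradedProj hV 0 ⁅X₁, (x : g)⁆ = 0
    rw [gradedProj_lie hV hbr hX₁ (k := -1) (by ring), (hA x).mp x.2 _ (by omega), lie_zero]
  have h₁ := N.finrank_range_add_finrank_ker
  have h₂ := P.finrank_range_add_finrank_ker
  rw [LinearMap.range_eq_top.mpr hP, finrank_top] at h₂
  have h₃ := Submodule.finrank_mono hNP
  have h₄ : Module.finrank ℂ (LinearMap.ker N) ≤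
      Module.finrank ℂ (LinearMap.ker (LieAlgebra.ad ℂ g X₁)) := by
    let f : LinearMap.ker N →ₗ[ℂ] LinearMap.ker (LieAlgebra.ad ℂ g X₁) :=
      A.subtype.restrict fun x hx => congrArg Subtype.val (LinearMap.mem_ker.mp hx)
    refine LinearMap.finrank_le_finrank_of_injective (f := f) fun x y hxy => ?_
    exact Subtype.ext (Subtype.ext (congrArg
      (fun z : LinearMap.ker (LieAlgebra.ad ℂ g X₁) => (z : g)) hxy))
  omega

/-- A nonzero scalar plus a degree-raising operator has trivial kernel on a grading bounded
below. -/
theorem eq_zero_of_smul_add_lie_eq_zero (hV : DirectSum.IsInternal V)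
    (hbr : ∀ k l : ℤ, ∀ x ∈ V k, ∀ y ∈ V l, ⁅x, y⁆ ∈ V (k + l)) {M : ℤ}
    (hbound : ∀ k ≤ M, V k = ⊥) {X₁ : g} (hX₁ : X₁ ∈ V 1)
    {c : ℂ} (hc : c ≠ 0) {x : g} (h : c • x + ⁅X₁, x⁆ = 0) : x = 0 := by
  have hle : ∀ k ≤ M, gradedProj hV k x = 0 := fun k hk =>
    gradedProj_eq_zero hV (hbound k hk) x
  refine eq_zero_of_gradedProj_eq_zero hV fun k => ?_
  obtain hk | hk := le_total k M
  · exact hle k hk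
  · induction k, hk using Int.leInduction with
    | base => exact hle M le_rfl
    | succ k _ ih =>
      have h' := congrArg (gradedProj hV (k + 1)) h
      rw [map_add, map_smul, gradedProj_lie hV hbr hX₁ (k := k) (by ring), ih, lie_zero,
        add_zero, map_zero] at h'
      exact (smul_eq_zero.mp h').resolve_left hc

end Grading

section FormalSolutions

variable {g : Type*} [LieRing g] [LieAlgebra ℂ g]

/-- The space of formal bi-infinite solutions `∑ vₙ tⁿ` of `t d/dt + ad X₁ + t ad X'`. -/
def formalSolutions (X₁ X' : g) : Submodule ℂ (ℤ → g) where
  carrier := {v | ∀ n : ℤ, (n : ℂ) • v n + ⁅X₁, v n⁆ + ⁅X', v (n - 1)⁆ = 0}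
  add_mem' := by
    intro v w hv hw n
    have h := congrArg₂ (· + ·) (hv n) (hw n)
    simp only [Pi.add_apply, lie_add, smul_add, add_zero] at h ⊢
    rw [← h]
    abel
  zero_mem' := by simp
  smul_mem' := by
    intro c v hv n
    have h := congrArg (c • ·) (hv n)
    simp only [smul_add, smul_zero] at h
    simpa only [Pi.smul_apply, lie_smul, smul_comm c (n : ℂ)] using h

/-- Every element of the centralizer of `X₁` extends to a power series solution. -/
theorem exists_mem_formalSolutions {X₁ X' : g}
    (hsurj : ∀ (n : ℕ) (y : g), ∃ x, ((n + 1 : ℕ) : ℂ) • x + ⁅X₁, x⁆ = y)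
    {w : g} (hw : ⁅X₁, w⁆ = 0) :
    ∃ v ∈ formalSolutions X₁ X', (∀ n < 0, v n = 0) ∧ v 0 = w := by
  choose f hf using hsurj
  let u : ℕ → g := fun n => Nat.rec w (fun n x => f n (-⁅X', x⁆)) n
  refine ⟨fun n => if n < 0 then 0 else u n.toNat, fun n => ?_, fun n hn => if_pos hn, rfl⟩
  obtain hn | rfl | hn := lt_trichotomy n 0
  · simp [hn, show n < 1 by omega]
  · simp [u, hw]
  · obtain ⟨k, rfl⟩ : ∃ k : ℕ, n = ((k + 1 : ℕ) : ℤ) := ⟨n.toNat - 1, by omega⟩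
    have h := hf k (-⁅X', u k⁆)
    have h₁ : ¬ (((k + 1 : ℕ) : ℤ) < 0) := by omega
    have h₂ : ¬ (((k + 1 : ℕ) : ℤ) - 1 < 0) := by omega
    have h₃ : (((k + 1 : ℕ) : ℤ) - 1).toNat = k := by omega
    simp only [h₁, h₂, h₃, if_false, Int.toNat_natCast, Int.cast_natCast]
    rw [← eq_neg_iff_add_eq_zero]
    exact h

/-- A solution vanishing in nonpositive degrees vanishes. -/
theorem eq_zero_of_mem_formalSolutions {X₁ X' : g}
    (hinj : ∀ (n : ℤ) (x : g), 0 < n → (n : ℂ) • x + ⁅X₁, x⁆ = 0 → x = 0)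
    {v : ℤ → g} (hv : v ∈ formalSolutions X₁ X') (h : ∀ n ≤ 0, v n = 0) : v = 0 := by
  funext n
  obtain hn | hn := le_total n 0
  · exact h n hn
  · induction n, hn using Int.leInduction with
    | base => exact h 0 le_rfl
    | succ n hn ih =>
      have h' := hv (n + 1)
      rw [add_sub_cancel_right, ih, Pi.zero_apply, lie_zero, add_zero] at h'
      exact hinj _ _ (by omega) h'

variable {V : ℤ → Submodule ℂ g}

theorem gradedProj_formalSolutions (hV : DirectSum.IsInternal V)
    (hbr : ∀ k l : ℤ, ∀ x ∈ V k, ∀ y ∈ V l, ⁅x, y⁆ ∈ V (k + l))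
    {m : ℕ} {X₁ X' : g} (hX₁ : X₁ ∈ V 1)
    (hX' : X' ∈ V (1 - m)) {v : ℤ → g} (hv : v ∈ formalSolutions X₁ X') (n k : ℤ) :
    (n : ℂ) • gradedProj hV (k + 1) (v n) + ⁅X₁, gradedProj hV k (v n)⁆ +
      ⁅X', gradedProj hV (k + m) (v (n - 1))⁆ = 0 := by
  have h := congrArg (gradedProj hV (k + 1)) (hv n)
  rwa [map_add, map_add, map_smul, gradedProj_lie hV hbr hX₁ (k := k) (by ring),
    gradedProj_lie hV hbr hX' (k := k + m) (by ring), map_zero] at h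

/-- The recursion satisfied by the components of a solution of total degree `m * q + r`, where
`t` has degree `m`. -/
theorem lie_gradedProj_add_gradedProj (hV : DirectSum.IsInternal V)
    (hbr : ∀ k l : ℤ, ∀ x ∈ V k, ∀ y ∈ V l, ⁅x, y⁆ ∈ V (k + l))
    {m : ℕ} (hbound : ∀ k : ℤ, (m : ℤ) ≤ |k| → V k = ⊥)
    {X₁ X' : g} (hX₁ : X₁ ∈ V 1) (hX' : X' ∈ V (1 - m)) {v : ℤ → g}
    (hv : v ∈ formalSolutions X₁ X') (q : ℤ) {r : ℤ} (hr : 0 ≤ r) (hrm : r < m) :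
    ⁅X₁ + X', gradedProj hV r (v q) + gradedProj hV (r - m) (v (q + 1))⁆ =
      -((q : ℂ) • gradedProj hV (r + 1) (v q) +
        ((q + 1 : ℤ) : ℂ) • gradedProj hV (r + 1 - m) (v (q + 1))) := by
  have h₁ := gradedProj_formalSolutions hV hbr hX₁ hX' hv q r
  have h₂ := gradedProj_formalSolutions hV hbr hX₁ hX' hv (q + 1) (r - m)
  have h₃ : gradedProj hV (r + m) (v (q - 1)) = 0 :=
    gradedProj_eq_zero hV (hbound _ (by rw [abs_of_nonneg] <;> omega)) _
  have h₄ : ⁅X', gradedProj hV (r - m) (v (q + 1))⁆ = 0 := by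
    have h := hbr _ _ X' hX' _ (gradedProj_mem hV (r - m) (v (q + 1)))
    rwa [hbound _ (by rw [abs_of_nonpos] <;> omega), Submodule.mem_bot] at h
  rw [h₃, lie_zero, add_zero] at h₁
  rw [sub_add_cancel, add_sub_cancel_right, show r - m + 1 = r + 1 - m by ring] at h₂
  rw [add_lie, lie_add, lie_add, h₄, add_zero, eq_neg_iff_add_eq_zero, ← add_zero (0 : g)]
  nth_rewrite 2 [← h₁]
  rw [← h₂]
  abel

/-- A formal solution is determined by the degree zero component of its coefficient `v₁`. -/
theorem eq_zero_of_gradedProj_zero_eq_zero [Module.Finite ℂ g] [LieAlgebra.IsKilling ℂ g]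
    (hV : DirectSum.IsInternal V)
    (hbr : ∀ k l : ℤ, ∀ x ∈ V k, ∀ y ∈ V l, ⁅x, y⁆ ∈ V (k + l))
    {m : ℕ} (hm : 0 < m) (hbound : ∀ k : ℤ, (m : ℤ) ≤ |k| → V k = ⊥)
    {X₁ X' : g} (hX₁ : X₁ ∈ V 1) (hX' : X' ∈ V (1 - m))
    (hCartan : (centralizerSubalgebra ℂ g (X₁ + X')).IsCartanSubalgebra)
    (hstable : ∀ x ∈ V 0, ⁅X₁ + X', x⁆ = 0 → x = 0)
    {v : ℤ → g} (hv : v ∈ formalSolutions X₁ X') (hv₁ : gradedProj hV 0 (v 1) = 0) :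
    v = 0 := by
  obtain ⟨ρ, hρ⟩ := exists_lie_eq_smul_of_isInternal hV hbr
  set w : ℤ → ℤ → g := fun q r =>
    gradedProj hV r (v q) + gradedProj hV (r - m) (v (q + 1)) with hw
  have hlie (q r : ℤ) (hr : 0 ≤ r) (hrm : r < m) := lie_gradedProj_add_gradedProj hV hbr
    hbound hX₁ hX' hv q hr hrm
  have hbot (k : ℤ) (hk : (m : ℤ) ≤ |k|) (x : g) : gradedProj hV k x = 0 :=
    gradedProj_eq_zero hV (hbound k hk) x
  have hw_zero (q : ℤ) : w q 0 = gradedProj hV 0 (v q) := by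
    simp only [hw]
    rw [hbot (0 - m) (by simp), add_zero]
  have hw_m (q : ℤ) : w q m = gradedProj hV 0 (v (q + 1)) := by
    simp only [hw]
    rw [hbot m (by simp), zero_add, sub_self]
  have hw_parts (q r : ℤ) (h : w q r = 0) :
      gradedProj hV r (v q) = 0 ∧ gradedProj hV (r - m) (v (q + 1)) = 0 := by
    have h' := congrArg (gradedProj hV r) h
    simp only [hw] at h h'
    rw [map_add, gradedProj_of_mem hV (gradedProj_mem hV r _),
      gradedProj_of_mem_ne hV (gradedProj_mem hV (r - m) _) (by omega), add_zero,
      map_zero] at h'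
    rw [h', zero_add] at h
    exact ⟨h', h⟩
  have hdown (q r : ℤ) (hr : 0 ≤ r) (hrm : r < m) (h : w q (r + 1) = 0) : w q r = 0 := by
    obtain ⟨ha, hb⟩ := hw_parts q (r + 1) h
    have hker : ⁅X₁ + X', w q r⁆ = 0 := by
      simp only [hw]
      rw [hlie q r hr hrm, ha, hb]
      simp
    obtain rfl | hr' := hr.eq_or_lt
    · refine hstable _ ?_ hker
      rw [hw_zero]
      exact gradedProj_mem hV 0 _
    · have hd : ((m * q + r : ℤ) : ℂ) ≠ 0 := by
        rw [Int.cast_ne_zero]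
        intro h0
        have hdvd : (m : ℤ) ∣ r := ⟨-q, by linarith⟩
        exact absurd (Int.le_of_dvd hr' hdvd) (by omega)
      refine eq_zero_of_smul_sub_lie_eq_lie hCartan hd hker (r := ρ)
        (z := -(m : ℂ) • w q (r - 1)) ?_
      have h' := hlie q (r - 1) (by omega) (by omega)
      rw [sub_add_cancel] at h'
      simp only [hw]
      rw [lie_smul, h', lie_add, hρ _ _ (gradedProj_mem hV _ _),
        hρ _ _ (gradedProj_mem hV _ _)]
      push_cast
      module
  have hdown' (q : ℤ) (h : w q m = 0) : ∀ r : ℤ, 0 ≤ r → r ≤ m → w q r = 0 := by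
    intro r hr hrm
    induction r, hrm using Int.leInductionDown with
    | base => exact h
    | pred r hrm ih =>
      exact hdown q (r - 1) hr (by omega) (by rw [sub_add_cancel]; exact ih (by omega))
  have hup (q : ℤ) (hq : 0 < q) (h : w q 0 = 0) : ∀ r : ℤ, 0 ≤ r → r ≤ m → w q r = 0 := by
    intro r hr
    induction r, hr using Int.leInduction with
    | base => exact fun _ => h
    | succ r hr ih =>
      intro hrm
      have h₀ := hlie q r hr (by omega)
      have h₁ : w q r = 0 := ih (by omega)
      simp only [hw] at h₁
      rw [h₁, lie_zero, zero_eq_neg] at h₀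
      have h₂ := congrArg (gradedProj hV (r + 1)) h₀
      rw [map_add, map_smul, map_smul, gradedProj_of_mem hV (gradedProj_mem hV (r + 1) _),
        gradedProj_of_mem_ne hV (gradedProj_mem hV (r + 1 - m) _) (by omega), smul_zero,
        add_zero, map_zero, smul_eq_zero, Int.cast_eq_zero] at h₂
      have h₃ := h₂.resolve_left hq.ne'
      rw [h₃, smul_zero, zero_add, smul_eq_zero, Int.cast_eq_zero] at h₀
      simp only [hw]
      rw [h₃, h₀.resolve_left (by omega), add_zero]
  have hzero (q : ℤ) : gradedProj hV 0 (v q) = 0 := by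
    obtain hq | hq := le_total q 1
    · induction q, hq using Int.leInductionDown with
      | base => exact hv₁
      | pred q _ ih =>
        rw [← hw_zero]
        exact hdown' (q - 1) (by rw [hw_m, sub_add_cancel, ih]) 0 le_rfl (by omega)
    · induction q, hq using Int.leInduction with
      | base => exact hv₁
      | succ q hq ih =>
        rw [← hw_m]
        exact hup q (by omega) (by rw [hw_zero, ih]) m (by omega) le_rfl
  have hall (q r : ℤ) (hr : 0 ≤ r) (hrm : r ≤ m) : w q r = 0 :=
    hdown' q (by rw [hw_m, hzero]) r hr hrm
  funext n
  refine eq_zero_of_gradedProj_eq_zero hV fun k => ?_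
  by_cases hk : (m : ℤ) ≤ |k|
  · exact hbot k hk _
  · rw [not_le, abs_lt] at hk
    obtain hk' | hk' := le_total 0 k
    · exact (hw_parts n k (hall n k hk' hk.2.le)).1
    · have h := (hw_parts (n - 1) (k + m) (hall (n - 1) (k + m) (by omega) (by omega))).2
      rwa [add_sub_cancel_right, sub_add_cancel] at h

end FormalSolutions

/-- In the setting of a stable grading (`g(k) = 0` for `|k| ≥ m`,
`X = X₁ + X'` regular semisimple with `ker(ad X) ∩ g₀ = 0`), the map `v ↦ v₀` is a
bijection from the space of all `v : ℤ → g` satisfying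
`n·vₙ + ⁅X₁, vₙ⁆ + ⁅X', v_{n-1}⁆ = 0` for every `n` onto the centralizer of `X₁`. -/
theorem formal_solutions_biject_with_centralizer_of_residue
    (g : Type*) [LieRing g] [LieAlgebra ℂ g] [Module.Finite ℂ g]
    [LieAlgebra.IsSemisimple ℂ g]
    (m : ℕ) (hm : 0 < m)
    (V : ℤ → Submodule ℂ g) (hV : DirectSum.IsInternal V)
    (hbr : ∀ k l : ℤ, ∀ x ∈ V k, ∀ y ∈ V l, ⁅x, y⁆ ∈ V (k + l))
    (hbound : ∀ k : ℤ, (m : ℤ) ≤ |k| → V k = ⊥)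
    (X₁ X' : g) (hX₁ : X₁ ∈ V 1) (hX' : X' ∈ V (1 - m))
    (X : g) (hX : X = X₁ + X')
    (hss : (LieAlgebra.ad ℂ g X).IsSemisimple)
    (hCartan : (centralizerSubalgebra ℂ g X).IsCartanSubalgebra)
    (g0 : Submodule ℂ g) (hg0 : g0 = ⨆ k : ℤ, ⨆ _ : (m : ℤ) ∣ k, V k)
    (hstable : LinearMap.ker (LieAlgebra.ad ℂ g X) ⊓ g0 = ⊥) :
    (∀ v v' : ℤ → g,
      (∀ n : ℤ, (n : ℂ) • v n + ⁅X₁, v n⁆ + ⁅X', v (n - 1)⁆ = 0) →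
      (∀ n : ℤ, (n : ℂ) • v' n + ⁅X₁, v' n⁆ + ⁅X', v' (n - 1)⁆ = 0) →
      v 0 = v' 0 → v = v') ∧
    (∀ v : ℤ → g,
      (∀ n : ℤ, (n : ℂ) • v n + ⁅X₁, v n⁆ + ⁅X', v (n - 1)⁆ = 0) →
      ⁅X₁, v 0⁆ = 0) ∧
    (∀ w : g, ⁅X₁, w⁆ = 0 →
      ∃ v : ℤ → g,
        (∀ n : ℤ, (n : ℂ) • v n + ⁅X₁, v n⁆ + ⁅X', v (n - 1)⁆ = 0) ∧ v 0 = w) := by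
  have hinj : ∀ (n : ℤ) (x : g), 0 < n → (n : ℂ) • x + ⁅X₁, x⁆ = 0 → x = 0 :=
    fun n x hn h => eq_zero_of_smul_add_lie_eq_zero hV hbr (M := -m)
      (fun k hk => hbound k (by rw [abs_of_nonpos] <;> omega)) hX₁
      (Int.cast_ne_zero.mpr hn.ne') h
  have hsurj : ∀ (n : ℕ) (y : g), ∃ x, ((n + 1 : ℕ) : ℂ) • x + ⁅X₁, x⁆ = y := by
    intro n
    let T : g →ₗ[ℂ] g := ((n + 1 : ℕ) : ℂ) • LinearMap.id + LieAlgebra.ad ℂ g X₁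
    have hT : Function.Injective T := (injective_iff_map_eq_zero T).mpr fun x hx =>
      hinj (n + 1 : ℕ) x (by omega) (by rw [Int.cast_natCast]; exact hx)
    exact LinearMap.injective_iff_surjective.mp hT
  have hstable' : ∀ x ∈ V 0, ⁅X₁ + X', x⁆ = 0 → x = 0 := by
    intro x hx h
    have hx' : x ∈ LinearMap.ker (LieAlgebra.ad ℂ g X) ⊓ g0 := by
      refine ⟨by rw [hX]; exact h, ?_⟩
      rw [hg0]
      exact Submodule.mem_iSup_of_mem 0 (Submodule.mem_iSup_of_mem (dvd_zero _) hx)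
    rwa [hstable, Submodule.mem_bot] at hx'
  subst hX
  let S := formalSolutions X₁ X'
  let Φ : S →ₗ[ℂ] V 0 := (gradedProj hV 0 ∘ₗ LinearMap.proj 1).restrict
    fun v _ => gradedProj_mem hV 0 (v 1)
  have hΦ : Function.Injective Φ := (injective_iff_map_eq_zero Φ).mpr fun v hv =>
    Subtype.ext (eq_zero_of_gradedProj_zero_eq_zero hV hbr hm hbound hX₁ hX' hCartan hstable'
      v.2 (congrArg Subtype.val hv))
  have : Module.Finite ℂ S := Module.Finite.of_injective Φ hΦ
  let Sp : Submodule ℂ S :=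
    ⨅ n : ℤ, ⨅ _ : n < 0, LinearMap.ker ((LinearMap.proj n : (ℤ → g) →ₗ[ℂ] g) ∘ₗ S.subtype)
  have hSp : ∀ v, v ∈ Sp ↔ ∀ n < 0, (v : ℤ → g) n = 0 := by simp [Sp]
  let Ψ : Sp →ₗ[ℂ] LinearMap.ker (LieAlgebra.ad ℂ g X₁) :=
    (LinearMap.proj 0 ∘ₗ S.subtype : S →ₗ[ℂ] g).restrict fun v hv => by
      have h := v.2 0
      rw [(hSp v).mp hv (0 - 1) (by omega)] at h
      simpa using h
  have hΨ : Function.Surjective Ψ := by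
    rintro ⟨w, hw⟩
    obtain ⟨v, hv, hneg, h0⟩ := exists_mem_formalSolutions (X' := X') hsurj
      (LinearMap.mem_ker.mp hw)
    exact ⟨⟨⟨v, hv⟩, (hSp _).mpr hneg⟩, Subtype.ext h0⟩
  have htop : Sp = ⊤ := by
    refine Submodule.eq_top_of_finrank_eq (le_antisymm (Submodule.finrank_le Sp) ?_)
    calc Module.finrank ℂ S ≤ Module.finrank ℂ (V 0) :=
          LinearMap.finrank_le_finrank_of_injective hΦ
      _ ≤ Module.finrank ℂ (LinearMap.ker (LieAlgebra.ad ℂ g X₁)) :=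
          finrank_le_finrank_ker_ad hV hbr hX₁
      _ ≤ Module.finrank ℂ Sp := LinearMap.finrank_le_finrank_of_surjective hΨ
  have hneg : ∀ v ∈ formalSolutions X₁ X', ∀ n < 0, v n = 0 := fun v hv =>
    (hSp ⟨v, hv⟩).mp (htop ▸ Submodule.mem_top)
  refine ⟨fun v v' hv hv' h => ?_, fun v hv => ?_, fun w hw => ?_⟩
  · have hsub : v - v' ∈ formalSolutions X₁ X' := Submodule.sub_mem _ hv hv'
    refine sub_eq_zero.mp (eq_zero_of_mem_formalSolutions hinj hsub fun n hn => ?_)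
    obtain hn | rfl := hn.lt_or_eq
    · exact hneg _ hsub n hn
    · simp [h]
  · have h := hv 0
    rw [hneg v hv (0 - 1) (by omega)] at h
    simpa using h
  · obtain ⟨v, hv, -, h0⟩ := exists_mem_formalSolutions (X' := X') hsurj hw
    exact ⟨v, hv, h0⟩
end
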